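/- arXiv:2411.08303 — 5 statements merged into one kernel-verified Lean document; each statement's English description precedes it below -/
import Mathlib

section
/- Let φ > 0 and τ > 1/φ. There exists a universal constant C > 0 such that for every Borel subset Q of ℝ there exists a smooth (infinitely differentiable) function g : ℝ → ℝ with ‖g'‖_∞ ≤ τ⁻¹, ‖g''‖_∞ ≤ C φ τ⁻¹, ‖g'''‖_∞ ≤ C φ² τ⁻¹, and (1 − ε) 1_Q(t) ≤ g(t) ≤ ε + (1 − ε) 1_{Q^{3τ}}(t) for all t ∈ ℝ, where ε = sqrt(e^{−α}(1+α)) with α = φ²τ² − 1 > 0. -/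
open scoped Convolution

/-- Convolving with a smooth compactly supported kernel multiplies Lipschitz constants by at most
the `L¹` norm of the kernel; expressed as a bound on the derivative. -/
theorem abs_deriv_convolution_le {f h : ℝ → ℝ} {K : NNReal} (hf : Continuous f)
    (hfc : HasCompactSupport f) (hh : LipschitzWith K h) (t : ℝ) :
    |deriv (f ⋆[ContinuousLinearMap.lsmul ℝ ℝ, MeasureTheory.volume] h) t| ≤
      (∫ s, |f s|) * K := by
  have hfi : MeasureTheory.Integrable (fun s => |f s|) :=
    (hf.integrable_of_hasCompactSupport hfc).abs
  have hI : 0 ≤ ∫ s, |f s| := MeasureTheory.integral_nonneg fun s => abs_nonneg _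
  have hi : ∀ x, MeasureTheory.Integrable (fun s => f s • h (x - s)) := fun x =>
    (hf.smul (hh.continuous.comp (continuous_const.sub continuous_id)))
      |>.integrable_of_hasCompactSupport hfc.smul_right
  have hL : LipschitzWith (⟨∫ s, |f s|, hI⟩ * K)
      (f ⋆[ContinuousLinearMap.lsmul ℝ ℝ, MeasureTheory.volume] h) := by
    refine LipschitzWith.of_dist_le_mul fun x y => ?_
    rw [MeasureTheory.convolution_lsmul, MeasureTheory.convolution_lsmul, dist_eq_norm,
      ← MeasureTheory.integral_sub (hi x) (hi y)]
    calc ‖∫ s, (f s • h (x - s) - f s • h (y - s))‖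
        ≤ ∫ s, |f s| * (K * dist x y) := by
          refine MeasureTheory.norm_integral_le_of_norm_le (hfi.mul_const _)
            (Filter.Eventually.of_forall fun s => ?_)
          rw [← smul_sub, norm_smul, Real.norm_eq_abs, ← dist_eq_norm]
          gcongr
          simpa using hh.dist_le_mul (x - s) (y - s)
      _ = _ := by
          rw [MeasureTheory.integral_mul_const, ← mul_assoc]
          rfl
  exact norm_deriv_le_of_lipschitz hL

theorem deriv_convolution_left {f h : ℝ → ℝ} (hf : ContDiff ℝ 1 f)
    (hfc : HasCompactSupport f) (hh : Continuous h) :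
    deriv (f ⋆[ContinuousLinearMap.lsmul ℝ ℝ, MeasureTheory.volume] h) =
      (deriv f) ⋆[ContinuousLinearMap.lsmul ℝ ℝ, MeasureTheory.volume] h :=
  funext fun t =>
    (hfc.hasDerivAt_convolution_left _ hf hh.locallyIntegrable t).deriv

/-- Smoothing a `[0, 1]`-valued Lipschitz function at unit scale. -/
theorem exists_smoothing_of_lipschitz :
    ∃ C : ℝ, 0 < C ∧ ∀ (K : NNReal) (h : ℝ → ℝ), LipschitzWith K h →
      (∀ t, 0 ≤ h t ∧ h t ≤ 1) →
      ∃ g : ℝ → ℝ, ContDiff ℝ (⊤ : ℕ∞) g ∧ (∀ t, 0 ≤ g t ∧ g t ≤ 1) ∧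
        (∀ t, (∀ x ∈ Metric.ball t 1, h x = h t) → g t = h t) ∧
        (∀ t, |deriv g t| ≤ K) ∧
        (∀ t, |deriv (deriv g) t| ≤ C * K) ∧
        (∀ t, |deriv (deriv (deriv g)) t| ≤ C * K) := by
  let b : ContDiffBump (0 : ℝ) := ⟨1 / 2, 1, by norm_num, by norm_num⟩
  let f : ℝ → ℝ := b.normed MeasureTheory.volume
  have hf : ContDiff ℝ (⊤ : ℕ∞) f := b.contDiff_normed
  have hf' : ContDiff ℝ (⊤ : ℕ∞) (deriv f) := (contDiff_infty_iff_deriv.1 hf).2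
  have hf'' : ContDiff ℝ (⊤ : ℕ∞) (deriv (deriv f)) := (contDiff_infty_iff_deriv.1 hf').2
  have hc : HasCompactSupport f := b.hasCompactSupport_normed
  have hc' : HasCompactSupport (deriv f) := hc.deriv
  have hc'' : HasCompactSupport (deriv (deriv f)) := hc'.deriv
  have h1 : ∫ s, |f s| = 1 := by
    simp_rw [f, abs_of_nonneg (b.nonneg_normed _)]
    exact b.integral_normed
  have hI₁ : 0 ≤ ∫ s, |deriv f s| := MeasureTheory.integral_nonneg fun s => abs_nonneg _
  have hI₂ : 0 ≤ ∫ s, |deriv (deriv f) s| := MeasureTheory.integral_nonneg fun s => abs_nonneg _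
  refine ⟨1 + (∫ s, |deriv f s|) + ∫ s, |deriv (deriv f) s|, by positivity,
    fun K h hh h01 => ⟨f ⋆[ContinuousLinearMap.lsmul ℝ ℝ, MeasureTheory.volume] h, ?_, ?_, ?_,
      ?_, ?_, ?_⟩⟩
  · exact hc.contDiff_convolution_left _ hf hh.continuous.locallyIntegrable
  · intro t
    have := abs_le.1 <| MeasureTheory.dist_convolution_le (x₀ := t) (z₀ := (1 / 2 : ℝ)) (by norm_num)
      b.support_normed_eq.subset b.nonneg_normed (b.integral_normed (μ := MeasureTheory.volume))
      hh.continuous.aestronglyMeasurable fun x _ =>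
        (abs_le.2 ⟨by linarith [(h01 x).1], by linarith [(h01 x).2]⟩ : |h x - 1 / 2| ≤ 1 / 2)
    constructor <;> linarith
  · exact fun t ht => b.normed_convolution_eq_right ht
  · intro t
    simpa [h1] using abs_deriv_convolution_le hf.continuous hc hh t
  · intro t
    rw [deriv_convolution_left (hf.of_le (by simp)) hc hh.continuous]
    refine (abs_deriv_convolution_le hf'.continuous hc' hh t).trans ?_
    gcongr
    linarith
  · intro t
    rw [deriv_convolution_left (hf.of_le (by simp)) hc hh.continuous,
      deriv_convolution_left (hf'.of_le (by simp)) hc' hh.continuous]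
    refine (abs_deriv_convolution_le hf''.continuous hc'' hh t).trans ?_
    gcongr
    linarith

theorem deriv_comp_const_mul (c : ℝ) (f : ℝ → ℝ) :
    deriv (fun x => f (c * x)) = fun x => c * deriv f (c * x) :=
  funext fun x => deriv_comp_mul_left c f x

theorem stmt_7 :
    ∃ C : ℝ, 0 < C ∧
      ∀ (φ τ : ℝ), 0 < φ → 1 / φ < τ →
        ∀ Q : Set ℝ, MeasurableSet Q →
          ∃ g : ℝ → ℝ, ContDiff ℝ (⊤ : ℕ∞) g ∧
            (∀ t, |deriv g t| ≤ τ⁻¹) ∧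
            (∀ t, |deriv (deriv g) t| ≤ C * φ * τ⁻¹) ∧
            (∀ t, |deriv (deriv (deriv g)) t| ≤ C * φ ^ 2 * τ⁻¹) ∧
            (∀ t : ℝ,
              (1 - Real.sqrt (Real.exp (-(φ ^ 2 * τ ^ 2 - 1)) * (1 + (φ ^ 2 * τ ^ 2 - 1)))) *
                  Q.indicator (fun _ => (1 : ℝ)) t ≤ g t ∧
              g t ≤ Real.sqrt (Real.exp (-(φ ^ 2 * τ ^ 2 - 1)) * (1 + (φ ^ 2 * τ ^ 2 - 1))) +
                (1 - Real.sqrt (Real.exp (-(φ ^ 2 * τ ^ 2 - 1)) * (1 + (φ ^ 2 * τ ^ 2 - 1)))) *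
                  (Metric.cthickening (3 * τ) Q).indicator (fun _ => (1 : ℝ)) t) := by
  obtain ⟨C, hC, H⟩ := exists_smoothing_of_lipschitz
  refine ⟨C, hC, fun φ τ hφ hτφ Q _ => ?_⟩
  have hτ : 0 < τ := lt_trans (by positivity) hτφ
  have hφτ : 1 < φ * τ := by rwa [div_lt_iff₀' hφ] at hτφ
  generalize hε : Real.sqrt (Real.exp (-(φ ^ 2 * τ ^ 2 - 1)) * (1 + (φ ^ 2 * τ ^ 2 - 1))) = ε
  have hε0 : 0 ≤ ε := hε ▸ Real.sqrt_nonneg _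
  rcases Q.eq_empty_or_nonempty with rfl | hQ
  · refine ⟨fun _ => 0, contDiff_const, ?_⟩
    simp only [deriv_const', abs_zero, Set.indicator_empty, Metric.cthickening_empty, mul_zero,
      le_refl, true_and, add_zero]
    exact ⟨fun _ => by positivity, fun _ => by positivity, fun _ => by positivity, fun _ => hε0⟩
  let d : ℝ → ℝ := fun u => 2 - τ⁻¹ * Metric.infDist (φ⁻¹ * u) Q
  let h : ℝ → ℝ := fun u => max 0 (min 1 (d u))
  have hd : ∀ x y, |d x - d y| ≤ τ⁻¹ * φ⁻¹ * |x - y| := by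
    intro x y
    have := (Metric.lipschitz_infDist_pt Q).dist_le_mul (φ⁻¹ * y) (φ⁻¹ * x)
    rw [Real.dist_eq, Real.dist_eq, ← mul_sub, abs_mul, abs_of_pos (inv_pos.2 hφ), abs_sub_comm y]
      at this
    have e : d x - d y = τ⁻¹ * (Metric.infDist (φ⁻¹ * y) Q - Metric.infDist (φ⁻¹ * x) Q) := by
      simp only [d]; ring
    rw [e, abs_mul, abs_of_pos (inv_pos.2 hτ), mul_assoc]
    gcongr
    simpa using this
  have hK : 0 ≤ τ⁻¹ * φ⁻¹ := by positivity
  have hdL : LipschitzWith ⟨τ⁻¹ * φ⁻¹, hK⟩ d := LipschitzWith.of_dist_le_mul hd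
  have hL : LipschitzWith ⟨τ⁻¹ * φ⁻¹, hK⟩ h := (hdL.const_min 1).const_max 0
  obtain ⟨g, hg, hg01, hgloc, hg1, hg2, hg3⟩ := H _ h hL fun t =>
    ⟨le_max_left _ _, max_le zero_le_one (min_le_left _ _)⟩
  have hnear : ∀ t, ∀ x ∈ Metric.ball (φ * t) 1, |d x - d (φ * t)| ≤ 1 := by
    intro t x hx
    rw [Metric.mem_ball, Real.dist_eq] at hx
    refine (hd _ _).trans ?_
    rw [← mul_inv, inv_mul_le_iff₀ (by positivity)]
    linarith [mul_comm φ τ]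
  have hdt : ∀ t, d (φ * t) = 2 - τ⁻¹ * Metric.infDist t Q := by
    intro t
    simp only [d, inv_mul_cancel_left₀ hφ.ne']
  have hD1 := deriv_comp_const_mul φ g
  have hD2 : deriv (deriv fun x => g (φ * x)) = fun x => φ ^ 2 * deriv (deriv g) (φ * x) := by
    rw [hD1, deriv_const_mul_field', deriv_comp_const_mul]
    ext x; simp; ring
  have hD3 : deriv (deriv (deriv fun x => g (φ * x))) =
      fun x => φ ^ 3 * deriv (deriv (deriv g)) (φ * x) := by
    rw [hD2, deriv_const_mul_field', deriv_comp_const_mul]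
    ext x; simp; ring
  refine ⟨fun x => g (φ * x), hg.comp (contDiff_const.mul contDiff_id), fun t => ?_, fun t => ?_,
    fun t => ?_, fun t => ⟨?_, ?_⟩⟩
  · rw [hD1, abs_mul, abs_of_pos hφ]
    calc _ ≤ φ * (τ⁻¹ * φ⁻¹) := by gcongr; exact hg1 _
      _ = _ := by field_simp
  · rw [hD2, abs_mul, abs_of_pos (by positivity)]
    calc _ ≤ φ ^ 2 * (C * (τ⁻¹ * φ⁻¹)) := by gcongr; exact hg2 _
      _ = _ := by field_simp
  · rw [hD3, abs_mul, abs_of_pos (by positivity)]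
    calc _ ≤ φ ^ 3 * (C * (τ⁻¹ * φ⁻¹)) := by gcongr; exact hg3 _
      _ = _ := by field_simp
  · by_cases ht : t ∈ Q
    · have h2 : d (φ * t) = 2 := by simp [hdt, Metric.infDist_zero_of_mem ht]
      have hone : ∀ x ∈ Metric.ball (φ * t) 1, h x = 1 := by
        intro x hx
        have := abs_le.1 (hnear t x hx)
        have h1 : 1 ≤ d x := by linarith
        simp [h, h1]
      have h0 := hone _ (Metric.mem_ball_self one_pos)
      have := hgloc _ fun x hx => (hone x hx).trans h0.symm
      simp only [this, h0, Set.indicator_of_mem ht]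
      linarith
    · simpa [ht] using (hg01 _).1
  · by_cases ht : t ∈ Metric.cthickening (3 * τ) Q
    · simpa [ht] using (hg01 _).2
    · have h3 : 3 * τ < Metric.infDist t Q := by
        by_contra! hle
        exact ht <| Metric.mem_cthickening_iff.2 <|
          (ENNReal.le_ofReal_iff_toReal_le (Metric.infEDist_ne_top hQ) (by positivity)).2 hle
      have h2 : d (φ * t) ≤ -1 := by
        have : 3 ≤ τ⁻¹ * Metric.infDist t Q := by
          rw [le_inv_mul_iff₀ hτ]; linarith
        rw [hdt]; linarith
      have hzero : ∀ x ∈ Metric.ball (φ * t) 1, h x = 0 := by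
        intro x hx
        have := abs_le.1 (hnear t x hx)
        exact max_eq_left ((min_le_right _ _).trans (by linarith))
      have h0 := hzero _ (Metric.mem_ball_self one_pos)
      have := hgloc _ fun x hx => (hzero x hx).trans h0.symm
      simpa [this, h0, ht] using hε0
end

section
/- Let β > 0, δ > 0 and let g : ℝ → ℝ be a thrice continuously differentiable function with bounded first and second derivatives. Then for every x ∈ ℝ^{n×m}, Σ_{i₁,i₂=1}^{n} Σ_{j₁,j₂=1}^{m} |∂²(g ∘ F^{βδ})(x) / (∂x_{i₁,j₁} ∂x_{i₂,j₂})| ≤ ‖g''‖_∞ + 2β(1+δ)‖g'‖_∞. -/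
open Real

/-- The smooth min-max approximation `F^{βδ}`. -/
noncomputable def Fbd (β δ : ℝ) {n m : ℕ} (x : Fin n → Fin m → ℝ) : ℝ :=
  -(1 / (β * δ)) * Real.log (∑ i, (∑ j, Real.exp (β * x i j)) ^ (-δ))

open Finset

/-- The inner sum `∑ j, exp (β x i j)`. -/
noncomputable def rowSum (β : ℝ) {n m : ℕ} (x : Fin n → Fin m → ℝ) (i : Fin n) : ℝ :=
  ∑ j, Real.exp (β * x i j)

/-- The outer sum `∑ i, (∑ j, exp (β x i j)) ^ (-δ)`. -/
noncomputable def outerSum (β δ : ℝ) {n m : ℕ} (x : Fin n → Fin m → ℝ) : ℝ :=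
  ∑ i, rowSum β x i ^ (-δ)

/-- The softmax weight of the entry `j` within the row `i`. -/
noncomputable def rowWeight (β : ℝ) {n m : ℕ} (x : Fin n → Fin m → ℝ) (i : Fin n) (j : Fin m) : ℝ :=
  Real.exp (β * x i j) / rowSum β x i

/-- The partial derivative of `Fbd` with respect to the entry `(i, j)`. -/
noncomputable def weight (β δ : ℝ) {n m : ℕ} (x : Fin n → Fin m → ℝ) (i : Fin n) (j : Fin m) : ℝ :=
  rowSum β x i ^ (-δ) / outerSum β δ x * rowWeight β x i j

section

variable {n m : ℕ} {β δ : ℝ}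

lemma rowSum_pos [NeZero m] (x : Fin n → Fin m → ℝ) (i : Fin n) : 0 < rowSum β x i :=
  sum_pos (fun _ _ => Real.exp_pos _) univ_nonempty

lemma outerSum_pos [NeZero n] [NeZero m] (x : Fin n → Fin m → ℝ) : 0 < outerSum β δ x :=
  sum_pos (fun i _ => Real.rpow_pos_of_pos (rowSum_pos x i) _) univ_nonempty

lemma rowWeight_nonneg [NeZero m] (x : Fin n → Fin m → ℝ) (i : Fin n) (j : Fin m) :
    0 ≤ rowWeight β x i j :=
  div_nonneg (Real.exp_pos _).le (rowSum_pos x i).le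

lemma sum_rowWeight [NeZero m] (x : Fin n → Fin m → ℝ) (i : Fin n) :
    ∑ j, rowWeight β x i j = 1 := by
  simp only [rowWeight, ← sum_div]
  exact div_self (rowSum_pos x i).ne'

lemma weight_nonneg [NeZero n] [NeZero m] (x : Fin n → Fin m → ℝ) (i : Fin n) (j : Fin m) :
    0 ≤ weight β δ x i j :=
  mul_nonneg (div_nonneg (Real.rpow_pos_of_pos (rowSum_pos x i) _).le (outerSum_pos x).le)
    (rowWeight_nonneg x i j)

lemma sum_weight [NeZero n] [NeZero m] (x : Fin n → Fin m → ℝ) :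
    ∑ i, ∑ j, weight β δ x i j = 1 := by
  simp only [weight, ← mul_sum, sum_rowWeight, mul_one, ← sum_div]
  exact div_self (outerSum_pos x).ne'

variable {c : ℝ → Fin n → Fin m → ℝ} {u : Fin n → Fin m → ℝ} {t : ℝ}

lemma hasDerivAt_rowSum [NeZero m] (hc : ∀ i j, HasDerivAt (fun s => c s i j) (u i j) t)
    (i : Fin n) :
    HasDerivAt (fun s => rowSum β (c s) i)
      (β * rowSum β (c t) i * ∑ j, rowWeight β (c t) i j * u i j) t := by
  have h := HasDerivAt.fun_sum (u := univ) fun j _ => ((hc i j).const_mul β).exp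
  refine h.congr_deriv ?_
  rw [mul_sum]
  refine sum_congr rfl fun j _ => ?_
  have := (rowSum_pos (β := β) (c t) i).ne'
  simp only [rowWeight]
  field_simp

lemma hasDerivAt_outerSum [NeZero n] [NeZero m]
    (hc : ∀ i j, HasDerivAt (fun s => c s i j) (u i j) t) :
    HasDerivAt (fun s => outerSum β δ (c s))
      (-(β * δ) * outerSum β δ (c t) * ∑ i, ∑ j, weight β δ (c t) i j * u i j) t := by
  have h := HasDerivAt.fun_sum (u := univ) fun i _ =>
    (hasDerivAt_rowSum (β := β) hc i).rpow_const (p := -δ) (Or.inl (rowSum_pos (c t) i).ne')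
  refine h.congr_deriv ?_
  rw [mul_sum]
  refine sum_congr rfl fun i _ => ?_
  have hS := rowSum_pos (β := β) (c t) i
  have hZ := (outerSum_pos (β := β) (δ := δ) (c t)).ne'
  simp only [weight, mul_assoc, ← mul_sum]
  rw [Real.rpow_sub_one hS.ne']
  have := hS.ne'
  field_simp

lemma hasDerivAt_Fbd [NeZero n] [NeZero m] (hβ : β ≠ 0) (hδ : δ ≠ 0)
    (hc : ∀ i j, HasDerivAt (fun s => c s i j) (u i j) t) :
    HasDerivAt (fun s => Fbd β δ (c s)) (∑ i, ∑ j, weight β δ (c t) i j * u i j) t := by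
  have hZ := (outerSum_pos (β := β) (δ := δ) (c t)).ne'
  have h := ((hasDerivAt_outerSum (β := β) (δ := δ) hc).log hZ).const_mul (-(1 / (β * δ)))
  refine h.congr_deriv ?_
  field_simp

lemma hasDerivAt_weight [NeZero n] [NeZero m]
    (hc : ∀ i j, HasDerivAt (fun s => c s i j) (u i j) t) (i : Fin n) (j : Fin m) :
    HasDerivAt (fun s => weight β δ (c s) i j)
      (weight β δ (c t) i j * (β * δ * (∑ i, ∑ j, weight β δ (c t) i j * u i j)
        - β * (1 + δ) * (∑ j, rowWeight β (c t) i j * u i j) + β * u i j)) t := by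
  have hZ := (outerSum_pos (β := β) (δ := δ) (c t)).ne'
  have hS := (rowSum_pos (β := β) (c t) i).ne'
  have hr := hasDerivAt_rowSum (β := β) hc i
  have h := ((hr.rpow_const (p := -δ) (Or.inl hS)).div
    (hasDerivAt_outerSum (β := β) (δ := δ) hc) hZ).mul (((hc i j).const_mul β).exp.div hr hS)
  refine h.congr_deriv ?_
  generalize ∑ i, ∑ j, weight β δ (c t) i j * u i j = A
  generalize ∑ j, rowWeight β (c t) i j * u i j = B
  simp only [weight, rowWeight, Pi.div_apply]
  rw [Real.rpow_sub_one hS]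
  field_simp
  ring

lemma contDiff_Fbd [NeZero n] [NeZero m] {k : WithTop ℕ∞} :
    ContDiff ℝ k (Fbd β δ : (Fin n → Fin m → ℝ) → ℝ) := by
  have hS : ∀ i, ContDiff ℝ k (fun x : Fin n → Fin m → ℝ => rowSum β x i) := fun i =>
    ContDiff.sum fun j _ => by fun_prop
  have hZ : ContDiff ℝ k (fun x : Fin n → Fin m → ℝ => outerSum β δ x) :=
    ContDiff.sum fun i _ => (hS i).rpow_const_of_ne fun x => (rowSum_pos x i).ne'
  exact contDiff_const.mul (hZ.log fun x => (outerSum_pos x).ne')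

lemma fderiv_eq_of_line {E : Type*} [NormedAddCommGroup E] [NormedSpace ℝ E] {f : E → ℝ} {x v : E}
    {d : ℝ} (hf : DifferentiableAt ℝ f x)
    (h : HasDerivAt (fun t : ℝ => f (x + t • v)) d 0) : fderiv ℝ f x v = d :=
  hf.hasFDerivAt.hasLineDerivAt v |>.unique h

lemma hasDerivAt_line (x u : Fin n → Fin m → ℝ) (i : Fin n) (j : Fin m) :
    HasDerivAt (fun t : ℝ => (x + t • u) i j) (u i j) 0 := by
  simpa using ((hasDerivAt_id (0 : ℝ)).mul_const (u i j)).const_add (x i j)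

lemma sum_sum_mul_single (a : Fin n → Fin m → ℝ) (i : Fin n) (j : Fin m) :
    ∑ i', ∑ j', a i' j' * (Pi.single i (Pi.single j 1) : Fin n → Fin m → ℝ) i' j' = a i j := by
  rw [sum_eq_single i (fun b _ hb => by simp [hb]) (by simp)]
  simp [Pi.single_apply]

lemma fderiv_comp_Fbd [NeZero n] [NeZero m] (hβ : β ≠ 0) (hδ : δ ≠ 0) {g : ℝ → ℝ}
    (hg : Differentiable ℝ g) (y v : Fin n → Fin m → ℝ) :
    fderiv ℝ (fun y => g (Fbd β δ y)) y v
      = deriv g (Fbd β δ y) * ∑ i, ∑ j, weight β δ y i j * v i j := by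
  have hF : Differentiable ℝ (Fbd β δ : (Fin n → Fin m → ℝ) → ℝ) :=
    (contDiff_Fbd (k := 1)).differentiable (by simp)
  refine fderiv_eq_of_line (hg.comp hF y) ?_
  have h := hasDerivAt_Fbd hβ hδ (hasDerivAt_line y v)
  exact (HasDerivAt.comp (0 : ℝ) (hg _).hasDerivAt h).congr_deriv (by simp)

lemma iteratedFDeriv_two_comp_Fbd [NeZero n] [NeZero m] (hβ : β ≠ 0) (hδ : δ ≠ 0) {g : ℝ → ℝ}
    (hg : ContDiff ℝ 2 g) (x u : Fin n → Fin m → ℝ) (i : Fin n) (j : Fin m) :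
    iteratedFDeriv ℝ 2 (fun y => g (Fbd β δ y)) x ![u, Pi.single i (Pi.single j 1)]
      = deriv (deriv g) (Fbd β δ x) * (∑ i, ∑ j, weight β δ x i j * u i j) * weight β δ x i j
        + deriv g (Fbd β δ x) * (weight β δ x i j *
          (β * δ * (∑ i, ∑ j, weight β δ x i j * u i j)
            - β * (1 + δ) * (∑ j, rowWeight β x i j * u i j) + β * u i j)) := by
  have hf : ContDiff ℝ 2 (fun y : Fin n → Fin m → ℝ => g (Fbd β δ y)) := hg.comp contDiff_Fbd
  have hf' : Differentiable ℝ (fderiv ℝ (fun y : Fin n → Fin m → ℝ => g (Fbd β δ y))) :=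
    (hf.fderiv_right (m := 1) (by norm_num)).differentiable (by simp)
  have hg' : Differentiable ℝ (deriv g) :=
    ((contDiff_succ_iff_deriv (n := 1)).1 hg).2.2.differentiable (by simp)
  set v : Fin n → Fin m → ℝ := Pi.single i (Pi.single j 1) with hv
  rw [iteratedFDeriv_two_apply]
  simp only [Matrix.cons_val_zero, Matrix.cons_val_one]
  have happly : fderiv ℝ (fderiv ℝ fun y => g (Fbd β δ y)) x u v
      = fderiv ℝ (fun y => fderiv ℝ (fun y => g (Fbd β δ y)) y v) x u := by
    rw [fderiv_clm_apply (hf' x) (differentiableAt_const v)]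
    simp
  rw [happly]
  refine fderiv_eq_of_line ((hf' x).clm_apply (differentiableAt_const v)) ?_
  simp only [fderiv_comp_Fbd hβ hδ (hg.differentiable (by simp)), hv, sum_sum_mul_single]
  have hl := hasDerivAt_line x u
  have h := (HasDerivAt.comp (0 : ℝ) (hg' _).hasDerivAt (hasDerivAt_Fbd hβ hδ hl)).mul
    (hasDerivAt_weight (β := β) (δ := δ) hl i j)
  exact h.congr_deriv (by simp)

lemma abs_iteratedFDeriv_two_comp_Fbd_le [NeZero n] [NeZero m] (hβ : 0 < β) (hδ : 0 < δ)
    {g : ℝ → ℝ} (hg : ContDiff ℝ 2 g) (x : Fin n → Fin m → ℝ) (i₁ i₂ : Fin n) (j₁ j₂ : Fin m) :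
    |iteratedFDeriv ℝ 2 (fun y => g (Fbd β δ y)) x
        ![Pi.single i₁ (Pi.single j₁ 1), Pi.single i₂ (Pi.single j₂ 1)]|
      ≤ |deriv (deriv g) (Fbd β δ x)| * (weight β δ x i₁ j₁ * weight β δ x i₂ j₂)
        + |deriv g (Fbd β δ x)| * (β * δ * (weight β δ x i₁ j₁ * weight β δ x i₂ j₂)
          + β * (1 + δ) * (if i₁ = i₂ then weight β δ x i₂ j₂ * rowWeight β x i₂ j₁ else 0)
          + β * (if i₁ = i₂ then if j₁ = j₂ then weight β δ x i₂ j₂ else 0 else 0)) := by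
  rw [iteratedFDeriv_two_comp_Fbd hβ.ne' hδ.ne' hg, sum_sum_mul_single]
  have h₁ := weight_nonneg (β := β) (δ := δ) x i₁ j₁
  have h₂ := weight_nonneg (β := β) (δ := δ) x i₂ j₂
  have hr := rowWeight_nonneg (β := β) x i₂ j₁
  refine (abs_add_le _ _).trans (add_le_add ?_ ?_)
  · rw [mul_assoc, abs_mul, abs_of_nonneg (mul_nonneg h₁ h₂)]
  · rw [abs_mul]
    refine mul_le_mul_of_nonneg_left ?_ (abs_nonneg _)
    have e₁ : ∑ j, rowWeight β x i₂ j * (Pi.single i₁ (Pi.single j₁ 1) : Fin n → Fin m → ℝ) i₂ j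
        = if i₁ = i₂ then rowWeight β x i₂ j₁ else 0 := by
      by_cases h : i₁ = i₂
      · subst h; simp [Pi.single_apply]
      · simp [h, Ne.symm h]
    have e₂ : (Pi.single i₁ (Pi.single j₁ 1) : Fin n → Fin m → ℝ) i₂ j₂
        = if i₁ = i₂ then if j₁ = j₂ then 1 else 0 else 0 := by
      by_cases h : i₁ = i₂
      · subst h; simp [Pi.single_apply, eq_comm]
      · simp [h, Ne.symm h]
    rw [e₁, e₂, abs_mul, abs_of_nonneg h₂]
    have key : ∀ {a b c : ℝ}, 0 ≤ a → 0 ≤ b → 0 ≤ c → |a - b + c| ≤ a + b + c :=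
      fun ha hb hc => abs_le.2 ⟨by linarith, by linarith⟩
    refine (mul_le_mul_of_nonneg_left
      (key (by positivity) (by positivity) (by positivity)) h₂).trans (le_of_eq ?_)
    split_ifs <;> ring

end

theorem stmt_8 (n m : ℕ) (β δ : ℝ) (hβ : 0 < β) (hδ : 0 < δ)
    (g : ℝ → ℝ) (hg : ContDiff ℝ 3 g)
    (hg1 : ∃ M, ∀ t, |deriv g t| ≤ M)
    (hg2 : ∃ M, ∀ t, |deriv (deriv g) t| ≤ M)
    (x : Fin n → Fin m → ℝ) :
    ∑ i₁, ∑ i₂, ∑ j₁, ∑ j₂,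
        |iteratedFDeriv ℝ 2 (fun y => g (Fbd β δ y)) x
          ![Pi.single i₁ (Pi.single j₁ 1), Pi.single i₂ (Pi.single j₂ 1)]|
      ≤ (⨆ t, |deriv (deriv g) t|) + 2 * β * (1 + δ) * ⨆ t, |deriv g t| := by
  rcases Nat.eq_zero_or_pos n with rfl | hn
  · simp only [univ_eq_empty, sum_empty]
    have := Real.iSup_nonneg fun t => abs_nonneg (deriv (deriv g) t)
    have := Real.iSup_nonneg fun t => abs_nonneg (deriv g t)
    positivity
  rcases Nat.eq_zero_or_pos m with rfl | hm
  · simp only [univ_eq_empty, sum_empty, sum_const_zero]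
    have := Real.iSup_nonneg fun t => abs_nonneg (deriv (deriv g) t)
    have := Real.iSup_nonneg fun t => abs_nonneg (deriv g t)
    positivity
  have : NeZero n := ⟨hn.ne'⟩
  have : NeZero m := ⟨hm.ne'⟩
  have hs₁ : |deriv g (Fbd β δ x)| ≤ ⨆ t, |deriv g t| :=
    le_ciSup (f := fun t => |deriv g t|) (hg1.imp fun M hM => by rintro _ ⟨t, rfl⟩; exact hM t) _
  have hs₂ : |deriv (deriv g) (Fbd β δ x)| ≤ ⨆ t, |deriv (deriv g) t| :=
    le_ciSup (f := fun t => |deriv (deriv g) t|)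
      (hg2.imp fun M hM => by rintro _ ⟨t, rfl⟩; exact hM t) _
  have hg' : ContDiff ℝ 2 g := hg.of_le (by norm_num)
  have hA : ∑ i₁, ∑ i₂, ∑ j₁, ∑ j₂, weight β δ x i₁ j₁ * weight β δ x i₂ j₂ = 1 := by
    simp only [← mul_sum, ← sum_mul, sum_weight, mul_one]
  have hB : ∑ i₁, ∑ i₂, ∑ j₁, ∑ j₂,
      (if i₁ = i₂ then weight β δ x i₂ j₂ * rowWeight β x i₂ j₁ else 0) = 1 := by
    rw [← sum_weight (β := β) (δ := δ) x]
    refine sum_congr rfl fun i _ => ?_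
    rw [sum_eq_single i (fun b _ hb => by simp [hb.symm]) (by simp)]
    simp only [if_true, ← sum_mul, ← mul_sum, sum_rowWeight, mul_one]
  have hC : ∑ i₁, ∑ i₂, ∑ j₁, ∑ j₂,
      (if i₁ = i₂ then if j₁ = j₂ then weight β δ x i₂ j₂ else 0 else 0) = 1 := by
    rw [← sum_weight (β := β) (δ := δ) x]
    refine sum_congr rfl fun i _ => ?_
    rw [sum_eq_single i (fun b _ hb => by simp [hb.symm]) (by simp)]
    simp
  calc
    _ ≤ |deriv (deriv g) (Fbd β δ x)| + |deriv g (Fbd β δ x)| * (2 * β * (1 + δ)) := by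
      refine (sum_le_sum fun i₁ _ => sum_le_sum fun i₂ _ => sum_le_sum fun j₁ _ =>
        sum_le_sum fun j₂ _ =>
          abs_iteratedFDeriv_two_comp_Fbd_le hβ hδ hg' x i₁ i₂ j₁ j₂).trans (le_of_eq ?_)
      simp only [sum_add_distrib, ← mul_sum] at hA hB hC ⊢
      rw [hA, hB, hC]
      ring
    _ ≤ _ := by
      rw [mul_comm |deriv g _|]
      exact add_le_add hs₂ (mul_le_mul_of_nonneg_left hs₁ (by positivity))
end

section
/- Let β > 0, δ > 0. For every x ∈ ℝ^{n×m} and every 1 ≤ i₁ ≤ n, 1 ≤ j₁ ≤ m, the partial derivative of F^{βδ} satisfies ∂F^{βδ}(x)/∂x_{i₁,j₁} = π_{i₁,j₁}(x) = p_{i₁,j₁}(x) q_{i₁}(x). -/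
open Real

/-- The weight `p_{i,j}(x)`. -/
noncomputable def pw (β : ℝ) {n m : ℕ} (x : Fin n → Fin m → ℝ) (i : Fin n) (j : Fin m) : ℝ :=
  Real.exp (β * x i j) / ∑ j', Real.exp (β * x i j')

/-- The weight `q_i(x)`. -/
noncomputable def qw (β δ : ℝ) {n m : ℕ} (x : Fin n → Fin m → ℝ) (i : Fin n) : ℝ :=
  (∑ j, Real.exp (β * x i j)) ^ (-δ) / ∑ i', (∑ j, Real.exp (β * x i' j)) ^ (-δ)

/-- The weight `π_{i,j}(x) = p_{i,j}(x) q_i(x)`. -/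
noncomputable def piw (β δ : ℝ) {n m : ℕ} (x : Fin n → Fin m → ℝ) (i : Fin n) (j : Fin m) : ℝ :=
  pw β x i j * qw β δ x i

/-- Kronecker delta. -/
def kron {α : Type*} [DecidableEq α] (a b : α) : ℝ := if a = b then 1 else 0

/-- The quantity `ω_{i₁,j₁,i₂,j₂}(x)`, equal to `β⁻¹` times the second partial derivative
of `F^{βδ}`. -/
noncomputable def omw (β δ : ℝ) {n m : ℕ} (x : Fin n → Fin m → ℝ)
    (i₁ : Fin n) (j₁ : Fin m) (i₂ : Fin n) (j₂ : Fin m) : ℝ :=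
  piw β δ x i₁ j₁ * (δ * piw β δ x i₂ j₂ + kron i₁ i₂ * (kron j₁ j₂ - (1 + δ) * pw β x i₂ j₂))

/-- The quantity `γ_{i₁,j₁,i₂,j₂,i₃,j₃}(x)`, equal to `β⁻²` times the third partial derivative
of `F^{βδ}`. -/
noncomputable def gaw (β δ : ℝ) {n m : ℕ} (x : Fin n → Fin m → ℝ)
    (i₁ : Fin n) (j₁ : Fin m) (i₂ : Fin n) (j₂ : Fin m) (i₃ : Fin n) (j₃ : Fin m) : ℝ :=
  omw β δ x i₁ j₁ i₂ j₂ * (δ * piw β δ x i₃ j₃ + kron i₁ i₃ * (kron j₁ j₃ - (1 + δ) * pw β x i₃ j₃))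
    + δ * piw β δ x i₁ j₁ * omw β δ x i₂ j₂ i₃ j₃
    - kron i₁ i₂ * kron i₂ i₃ * (1 + δ) * piw β δ x i₁ j₁ * pw β x i₂ j₂ *
        (kron j₂ j₃ - pw β x i₃ j₃)

/-- The full derivative of a row sum `∑ j, exp (β x_{i,j})`. -/
theorem hasFDerivAt_sum_exp_row (β : ℝ) {n m : ℕ} (x : Fin n → Fin m → ℝ) (i : Fin n) :
    HasFDerivAt (fun y : Fin n → Fin m → ℝ => ∑ j, Real.exp (β * y i j))
      (∑ j, (Real.exp (β * x i j) * β) •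
        (ContinuousLinearMap.proj (R := ℝ) (φ := fun _ : Fin m => ℝ) j).comp
          (ContinuousLinearMap.proj (R := ℝ) (φ := fun _ : Fin n => Fin m → ℝ) i)) x := by
  refine HasFDerivAt.fun_sum fun j _ => ?_
  have h := (((ContinuousLinearMap.proj (R := ℝ) (φ := fun _ : Fin m => ℝ) j).comp
    (ContinuousLinearMap.proj (R := ℝ) (φ := fun _ : Fin n => Fin m → ℝ) i)).hasFDerivAt
      (x := x)).const_mul β |>.exp
  simpa [smul_smul] using h

theorem stmt_10 (n m : ℕ) (β δ : ℝ) (hβ : 0 < β) (hδ : 0 < δ)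
    (x : Fin n → Fin m → ℝ) (i₁ : Fin n) (j₁ : Fin m) :
    fderiv ℝ (Fbd β δ (n := n) (m := m)) x (Pi.single i₁ (Pi.single j₁ 1)) =
      piw β δ x i₁ j₁ := by
  have hS : ∀ i, 0 < ∑ j, Real.exp (β * x i j) := fun i =>
    Finset.sum_pos (fun j _ => Real.exp_pos _) ⟨j₁, Finset.mem_univ _⟩
  have hT : 0 < ∑ i, (∑ j, Real.exp (β * x i j)) ^ (-δ) :=
    Finset.sum_pos (fun i _ => Real.rpow_pos_of_pos (hS i) _) ⟨i₁, Finset.mem_univ _⟩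
  have hF := ((HasFDerivAt.fun_sum (u := Finset.univ) fun i _ =>
    (hasFDerivAt_sum_exp_row β x i).rpow_const (p := -δ) (Or.inl (hS i).ne')).log
      hT.ne').const_mul (-(1 / (β * δ)))
  have hF' : fderiv ℝ (Fbd β δ (n := n) (m := m)) x = _ := hF.fderiv
  have hrow : ∀ i, ∑ j, Real.exp (β * x i j) * β *
      (Pi.single i₁ (Pi.single j₁ 1) : Fin n → Fin m → ℝ) i j =
        if i = i₁ then Real.exp (β * x i₁ j₁) * β else 0 := by
    intro i
    split_ifs with h
    · subst h
      simp [Pi.single_apply]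
    · simp [Pi.single_eq_of_ne h]
  rw [hF']
  simp only [smul_apply, sum_apply,
    ContinuousLinearMap.comp_apply, ContinuousLinearMap.proj_apply, smul_eq_mul, hrow,
    mul_ite, mul_zero, Finset.sum_ite_eq', Finset.mem_univ, if_true]
  rw [Real.rpow_sub_one (hS i₁).ne']
  unfold piw pw qw
  have := (hS i₁).ne'
  have := hT.ne'
  field_simp
end

section
/- Let β > 0, δ > 0. For every x ∈ ℝ^{n×m}, Σ_{i₁,i₂=1}^{n} Σ_{j₁,j₂=1}^{m} |ω_{i₁,j₁,i₂,j₂}(x)| ≤ 2(1+δ), where ω_{i₁,j₁,i₂,j₂}(x) = π_{i₁,j₁}(x) ( δ π_{i₂,j₂}(x) + δ_{i₁,i₂} ( δ_{j₁,j₂} − (1+δ) p_{i₂,j₂}(x) ) ). -/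
open Real

theorem sum_div_sum_le_one {ι : Type*} [Fintype ι] (f : ι → ℝ) :
    ∑ i, f i / ∑ i', f i' ≤ 1 := by
  rw [← Finset.sum_div]
  exact div_self_le_one _

section Weights

variable (β δ : ℝ) {n m : ℕ} (x : Fin n → Fin m → ℝ)

theorem pw_nonneg (i : Fin n) (j : Fin m) : 0 ≤ pw β x i j := by
  unfold pw
  positivity

theorem sum_pw_le_one (i : Fin n) : ∑ j, pw β x i j ≤ 1 :=
  sum_div_sum_le_one fun j => Real.exp (β * x i j)

theorem qw_nonneg (i : Fin n) : 0 ≤ qw β δ x i := by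
  unfold qw
  positivity

theorem sum_qw_le_one : ∑ i, qw β δ x i ≤ 1 :=
  sum_div_sum_le_one fun i => (∑ j, Real.exp (β * x i j)) ^ (-δ)

theorem piw_nonneg (i : Fin n) (j : Fin m) : 0 ≤ piw β δ x i j :=
  mul_nonneg (pw_nonneg β x i j) (qw_nonneg β δ x i)

theorem sum_piw_le_one : ∑ i, ∑ j, piw β δ x i j ≤ 1 := by
  refine le_trans (Finset.sum_le_sum fun i _ => ?_) (sum_qw_le_one β δ x)
  simp only [piw, ← Finset.sum_mul]
  exact mul_le_of_le_one_left (qw_nonneg β δ x i) (sum_pw_le_one β x i)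

theorem kron_nonneg {α : Type*} [DecidableEq α] (a b : α) : 0 ≤ kron a b := by
  unfold kron
  split_ifs <;> norm_num

variable {δ}

theorem abs_omw_le (hδ : 0 ≤ δ) (i₁ : Fin n) (j₁ : Fin m) (i₂ : Fin n) (j₂ : Fin m) :
    |omw β δ x i₁ j₁ i₂ j₂| ≤ piw β δ x i₁ j₁ *
      (δ * piw β δ x i₂ j₂ + kron i₁ i₂ * (kron j₁ j₂ + (1 + δ) * pw β x i₂ j₂)) := by
  rw [omw, abs_mul, abs_of_nonneg (piw_nonneg β δ x i₁ j₁)]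
  refine mul_le_mul_of_nonneg_left ?_ (piw_nonneg β δ x i₁ j₁)
  have h₁ := mul_nonneg hδ (piw_nonneg β δ x i₂ j₂)
  have h₂ := mul_nonneg (kron_nonneg i₁ i₂) (kron_nonneg j₁ j₂)
  have h₃ := mul_nonneg (kron_nonneg i₁ i₂)
    (mul_nonneg (by linarith : 0 ≤ 1 + δ) (pw_nonneg β x i₂ j₂))
  rw [abs_le]
  constructor <;> linarith

theorem sum_abs_omw_le (hδ : 0 ≤ δ) (i₁ : Fin n) (j₁ : Fin m) :
    ∑ i₂, ∑ j₂, |omw β δ x i₁ j₁ i₂ j₂| ≤ piw β δ x i₁ j₁ * (2 * (1 + δ)) := by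
  refine le_trans (Finset.sum_le_sum fun i₂ _ => Finset.sum_le_sum fun j₂ _ =>
    abs_omw_le β x hδ i₁ j₁ i₂ j₂) ?_
  simp only [← Finset.mul_sum]
  refine mul_le_mul_of_nonneg_left ?_ (piw_nonneg β δ x i₁ j₁)
  simp only [Finset.sum_add_distrib, ← Finset.mul_sum]
  simp only [kron, ite_mul, one_mul, zero_mul, Finset.sum_ite_eq, Finset.mem_univ, if_true]
  have h₁ := mul_le_mul_of_nonneg_left (sum_piw_le_one β δ x) hδ
  have h₂ := mul_le_mul_of_nonneg_left (sum_pw_le_one β x i₁) (by linarith : 0 ≤ 1 + δ)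
  linarith

end Weights

theorem stmt_12 (n m : ℕ) (β δ : ℝ) (hβ : 0 < β) (hδ : 0 < δ)
    (x : Fin n → Fin m → ℝ) :
    ∑ i₁, ∑ i₂, ∑ j₁, ∑ j₂, |omw β δ x i₁ j₁ i₂ j₂| ≤ 2 * (1 + δ) := by
  calc
    _ = ∑ i₁, ∑ j₁, ∑ i₂, ∑ j₂, |omw β δ x i₁ j₁ i₂ j₂| :=
      Finset.sum_congr rfl fun i₁ _ => Finset.sum_comm
    _ ≤ ∑ i₁, ∑ j₁, piw β δ x i₁ j₁ * (2 * (1 + δ)) :=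
      Finset.sum_le_sum fun i₁ _ => Finset.sum_le_sum fun j₁ _ => sum_abs_omw_le β x hδ.le i₁ j₁
    _ = (∑ i₁, ∑ j₁, piw β δ x i₁ j₁) * (2 * (1 + δ)) := by simp only [Finset.sum_mul]
    _ ≤ 2 * (1 + δ) := mul_le_of_le_one_left (by linarith) (sum_piw_le_one β δ x)
end

section
/- Let X be an n×m random matrix with mean-zero entries having finite absolute third moments, and let Y be a centered Gaussian n×m random matrix with the same covariance structure, i.e. E[X_{i₁,j₁}X_{i₂,j₂}] = E[Y_{i₁,j₁}Y_{i₂,j₂}] for all indices. Let β > 0, δ > 0, τ > 1/(β(1+δ)), and let g : ℝ → ℝ be a smooth function with ‖g'‖_∞ ≤ τ⁻¹, ‖g''‖_∞ ≤ C₀ β(1+δ) τ⁻¹, ‖g'''‖_∞ ≤ C₀ β²(1+δ)² τ⁻¹ for some constant C₀. Then, writing f = g ∘ F^{βδ}, one has |E[f(X)] − E[f(Y)]| ≤ (C β(1+δ)/τ)(B₁ + β(1+δ) B₂), where C depends only on C₀. -/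
open MeasureTheory ProbabilityTheory Real

/-- `X` is a centered (jointly) Gaussian random matrix under `P`: every linear combination
of its entries has a centered real Gaussian distribution. -/
def IsCenteredGaussianMatrix {Ω : Type*} [MeasurableSpace Ω] (P : Measure Ω)
    {n m : ℕ} (X : Ω → Fin n → Fin m → ℝ) : Prop :=
  ∀ c : Fin n → Fin m → ℝ, ∃ v : NNReal,
    Measure.map (fun ω => ∑ i, ∑ j, c i j * X ω i j) P = gaussianReal 0 v

section DerivativeBounds

variable {E F G : Type*} [NormedAddCommGroup E] [NormedSpace ℝ E] [NormedAddCommGroup F]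
  [NormedSpace ℝ F] [NormedAddCommGroup G] [NormedSpace ℝ G]

lemma norm_iteratedFDeriv_comp_clm_le {g : F → G} {N : WithTop ℕ∞} (hg : ContDiff ℝ N g)
    (L : E →L[ℝ] F) {c : ℝ} (hc : ‖L‖ ≤ c) (x : E) {k : ℕ} (hk : (k : WithTop ℕ∞) ≤ N) :
    ‖iteratedFDeriv ℝ k (fun y => g (L y)) x‖ ≤ c ^ k * ‖iteratedFDeriv ℝ k g (L x)‖ := by
  have h := L.iteratedFDeriv_comp_right hg x hk
  rw [show (fun y => g (L y)) = g ∘ L from rfl, h]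
  refine (ContinuousMultilinearMap.norm_compContinuousLinearMap_le _ _).trans ?_
  rw [mul_comm]
  gcongr
  simpa using pow_le_pow_left₀ (norm_nonneg L) hc k

lemma norm_iteratedFDeriv_sub_const (f : E → F) (c : F) {k : ℕ} (hk : 1 ≤ k) (x : E) :
    ‖iteratedFDeriv ℝ k (fun z => f z - c) x‖ = ‖iteratedFDeriv ℝ k f x‖ := by
  obtain ⟨j, rfl⟩ : ∃ j, k = j + 1 := ⟨k - 1, by omega⟩
  rw [← norm_iteratedFDeriv_fderiv, ← norm_iteratedFDeriv_fderiv]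
  congr 2
  ext z : 1
  exact fderiv_sub_const c

lemma norm_iteratedFDeriv_comp_le_of_pos {g : F → G} {f : E → F} {n : ℕ} (hn : 1 ≤ n)
    (hg : ContDiff ℝ n g) (hf : ContDiff ℝ n f) (x : E) {C D : ℝ} (hC0 : 0 ≤ C)
    (hC : ∀ i, 1 ≤ i → i ≤ n → ‖iteratedFDeriv ℝ i g (f x)‖ ≤ C)
    (hD : ∀ i, 1 ≤ i → i ≤ n → ‖iteratedFDeriv ℝ i f x‖ ≤ D ^ i) :
    ‖iteratedFDeriv ℝ n (fun y => g (f y)) x‖ ≤ n.factorial * C * D ^ n := by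
  rw [← norm_iteratedFDeriv_sub_const _ (g (f x)) hn x]
  refine norm_iteratedFDeriv_comp_le (g := fun z => g z - g (f x)) (hg.sub contDiff_const) hf
    le_rfl x (fun i hi => ?_) hD
  rcases Nat.eq_zero_or_pos i with rfl | hi'
  · simpa using hC0
  · rw [norm_iteratedFDeriv_sub_const g _ hi']
    exact hC i hi' hi

lemma norm_iteratedFDeriv_pi_le {ι : Type*} [Fintype ι] {f : E → ι → ℝ} {k : ℕ}
    (hf : ContDiff ℝ k f) (x : E) {C : ℝ} (hC0 : 0 ≤ C)
    (hC : ∀ i, ‖iteratedFDeriv ℝ k (fun y => f y i) x‖ ≤ C) :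
    ‖iteratedFDeriv ℝ k f x‖ ≤ C := by
  refine ContinuousMultilinearMap.opNorm_le_bound hC0 fun v => ?_
  refine (pi_norm_le_iff_of_nonneg (by positivity)).2 fun i => ?_
  have h := (ContinuousLinearMap.proj (R := ℝ) (φ := fun _ : ι => ℝ) i).iteratedFDeriv_comp_left
    hf.contDiffAt (x := x) le_rfl
  have h2 : iteratedFDeriv ℝ k f x v i = iteratedFDeriv ℝ k (fun y => f y i) x v := by
    rw [show (fun y => f y i) =
      (ContinuousLinearMap.proj (R := ℝ) (φ := fun _ : ι => ℝ) i) ∘ f from rfl, h]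
    rfl
  rw [h2]
  exact (ContinuousMultilinearMap.le_opNorm _ _).trans (by gcongr; exact hC i)

end DerivativeBounds

/-- The log-sum-exp function. -/
noncomputable def logSumExp {ι : Type*} [Fintype ι] (z : ι → ℝ) : ℝ :=
  Real.log (∑ i, Real.exp (z i))

section LogSumExp

variable {ι : Type*} [Fintype ι]

lemma sum_exp_pos [Nonempty ι] (z : ι → ℝ) : 0 < ∑ i, Real.exp (z i) :=
  Finset.sum_pos (fun _ _ => Real.exp_pos _) Finset.univ_nonempty

lemma contDiff_logSumExp [Nonempty ι] {N : WithTop ℕ∞} : ContDiff ℝ N (logSumExp : (ι → ℝ) → ℝ) := by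
  unfold logSumExp
  exact ContDiff.log (by fun_prop) fun z => (sum_exp_pos z).ne'

lemma norm_iteratedFDeriv_sum_exp_le (z : ι → ℝ) (k : ℕ) :
    ‖iteratedFDeriv ℝ k (fun y : ι → ℝ => ∑ i, Real.exp (y i)) z‖ ≤ ∑ i, Real.exp (z i) := by
  rw [iteratedFDeriv_fun_sum_apply (fun i _ => by fun_prop)]
  refine (norm_sum_le _ _).trans (Finset.sum_le_sum fun i _ => ?_)
  have h := norm_iteratedFDeriv_comp_clm_le (g := Real.exp) (N := k) Real.contDiff_exp
    (ContinuousLinearMap.proj (R := ℝ) (φ := fun _ : ι => ℝ) i) (c := 1)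
    (ContinuousLinearMap.opNorm_le_bound _ zero_le_one fun v => by
      simpa using norm_le_pi_norm v i) z le_rfl
  refine h.trans ?_
  rw [norm_iteratedFDeriv_eq_norm_iteratedDeriv, iteratedDeriv_eq_iterate, Real.iter_deriv_exp]
  simp

lemma norm_iteratedFDerivWithin_log_le {k : ℕ} (hk : k ≤ 3) :
    ‖iteratedFDerivWithin ℝ k Real.log (Set.Ioi 0) 1‖ ≤ 2 := by
  rw [iteratedFDerivWithin_of_isOpen k isOpen_Ioi (by simp),
    norm_iteratedFDeriv_eq_norm_iteratedDeriv]
  interval_cases k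
  · simp
  · simp [iteratedDeriv_one]
  · rw [iteratedDeriv_succ', Real.deriv_log', iteratedDeriv_one]
    simp
  · rw [iteratedDeriv_succ', Real.deriv_log', iteratedDeriv_eq_iterate]
    rw [iter_deriv_inv]
    simp

lemma norm_iteratedFDeriv_logSumExp_le [Nonempty ι] (z : ι → ℝ) {k : ℕ} (hk : 1 ≤ k) (hk3 : k ≤ 3) :
    ‖iteratedFDeriv ℝ k (logSumExp : (ι → ℝ) → ℝ) z‖ ≤ 12 := by
  set N : ℝ := ∑ i, Real.exp (z i) with hN
  have hNpos : 0 < N := sum_exp_pos z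
  set h : (ι → ℝ) → ℝ := fun y => N⁻¹ • ∑ i, Real.exp (y i) with hh
  have hfac : (k.factorial : ℝ) ≤ 6 := by
    exact_mod_cast (Nat.factorial_le hk3).trans (by decide)
  have hpos : ∀ y, h y ∈ Set.Ioi (0 : ℝ) := fun y => by
    have := sum_exp_pos y
    simp only [hh, smul_eq_mul, Set.mem_Ioi]; positivity
  have hhz : h z = 1 := by simp only [hh, smul_eq_mul]; exact inv_mul_cancel₀ hNpos.ne'
  have hcd : ContDiff ℝ k h := by fun_prop
  have h1 : ‖iteratedFDeriv ℝ k (Real.log ∘ h) z‖ ≤ k.factorial * 2 * 1 ^ k := by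
    refine norm_iteratedFDeriv_comp_le' (t := Set.Ioi 0) (Set.range_subset_iff.2 hpos)
      isOpen_Ioi.uniqueDiffOn
      (fun y hy => (Real.contDiffAt_log.2 (ne_of_gt hy)).contDiffWithinAt) hcd le_rfl z
      (fun i hi => ?_) (fun i _ hi => ?_)
    · rw [hhz]
      exact norm_iteratedFDerivWithin_log_le (hi.trans hk3)
    · rw [hh, iteratedFDeriv_const_smul_apply' (by fun_prop), norm_smul]
      have := norm_iteratedFDeriv_sum_exp_le z i
      rw [one_pow, Real.norm_of_nonneg (by positivity), inv_mul_le_iff₀ hNpos, mul_one]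
      exact this
  have h2 : (logSumExp : (ι → ℝ) → ℝ) = fun y => Real.log N + (Real.log ∘ h) y := by
    ext y
    simp only [logSumExp, hh, Function.comp, smul_eq_mul]
    rw [Real.log_mul (by positivity) (sum_exp_pos y).ne', Real.log_inv]
    ring
  obtain ⟨j, rfl⟩ : ∃ j, k = j + 1 := ⟨k - 1, by omega⟩
  have h3 : fderiv ℝ (logSumExp : (ι → ℝ) → ℝ) = fderiv ℝ (Real.log ∘ h) := by
    rw [h2]; ext y : 1; exact fderiv_const_add _
  rw [← norm_iteratedFDeriv_fderiv, h3, norm_iteratedFDeriv_fderiv]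
  refine h1.trans ?_
  rw [one_pow]; linarith

end LogSumExp

section MinMax

variable {n m : ℕ}

/-- The row-wise log-sum-exp map. -/
noncomputable def rowLogSumExp (β : ℝ) (x : Fin n → Fin m → ℝ) (i : Fin n) : ℝ :=
  logSumExp fun j => β * x i j

lemma contDiff_rowLogSumExp [NeZero m] (β : ℝ) {N : WithTop ℕ∞} :
    ContDiff ℝ N (rowLogSumExp (n := n) (m := m) β) :=
  contDiff_pi.2 fun i => contDiff_logSumExp.comp
    (g := logSumExp) (f := fun (x : Fin n → Fin m → ℝ) j => β * x i j) (by fun_prop)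

lemma norm_iteratedFDeriv_rowLogSumExp_le [NeZero m] {β : ℝ} (hβ : 0 ≤ β)
    (x : Fin n → Fin m → ℝ) {k : ℕ} (hk : 1 ≤ k) (hk3 : k ≤ 3) :
    ‖iteratedFDeriv ℝ k (rowLogSumExp β) x‖ ≤ β ^ k * 12 := by
  refine norm_iteratedFDeriv_pi_le (contDiff_rowLogSumExp β) x (by positivity) fun i => ?_
  let L : (Fin n → Fin m → ℝ) →L[ℝ] (Fin m → ℝ) :=
    β • ContinuousLinearMap.proj (R := ℝ) (φ := fun _ : Fin n => Fin m → ℝ) i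
  have hL : ‖L‖ ≤ β := ContinuousLinearMap.opNorm_le_bound _ hβ fun v => by
    simp only [L, smul_apply, ContinuousLinearMap.proj_apply, norm_smul,
      Real.norm_of_nonneg hβ]
    gcongr
    exact norm_le_pi_norm v i
  refine (norm_iteratedFDeriv_comp_clm_le (g := logSumExp) (N := k) contDiff_logSumExp L hL x
    le_rfl).trans ?_
  gcongr
  exact norm_iteratedFDeriv_logSumExp_le _ hk hk3

lemma Fbd_eq_logSumExp [NeZero m] {β δ : ℝ} (hβ : 0 < β) (hδ : 0 < δ)
    (x : Fin n → Fin m → ℝ) :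
    β * (1 + δ) * Fbd β δ x = -((1 + δ) / δ) * logSumExp
      ((δ / (1 + δ)) • (-(1 + δ)) • rowLogSumExp β x) := by
  have h1 : 0 < 1 + δ := by linarith
  have : ∀ i, (∑ j, Real.exp (β * x i j)) ^ (-δ) =
      Real.exp (((δ / (1 + δ)) • (-(1 + δ)) • rowLogSumExp β x) i) := fun i => by
    rw [Real.rpow_def_of_pos (sum_exp_pos _)]
    congr 1
    simp only [rowLogSumExp, logSumExp, Pi.smul_apply, smul_eq_mul]
    field_simp
  simp only [Fbd, this, logSumExp]
  field_simp

lemma contDiff_mul_Fbd [NeZero n] [NeZero m] {β δ : ℝ} (hβ : 0 < β) (hδ : 0 < δ)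
    {N : WithTop ℕ∞} :
    ContDiff ℝ N (fun x : Fin n → Fin m → ℝ => β * (1 + δ) * Fbd β δ x) := by
  simp only [Fbd_eq_logSumExp hβ hδ]
  refine contDiff_const.mul (contDiff_logSumExp.comp ?_)
  have := contDiff_rowLogSumExp (n := n) (m := m) β (N := N)
  fun_prop

lemma norm_iteratedFDeriv_mul_Fbd_le [NeZero n] [NeZero m] {β δ : ℝ} (hβ : 0 < β) (hδ : 0 < δ)
    (x : Fin n → Fin m → ℝ) {k : ℕ} (hk : 1 ≤ k) (hk3 : k ≤ 3) :
    ‖iteratedFDeriv ℝ k (fun x : Fin n → Fin m → ℝ => β * (1 + δ) * Fbd β δ x) x‖ ≤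
      (864 * (β * (1 + δ))) ^ k := by
  have h1 : 0 < 1 + δ := by linarith
  have hr : δ / (1 + δ) ≤ 1 := by rw [div_le_one h1]; linarith
  have hfac : (k.factorial : ℝ) ≤ 6 := by
    exact_mod_cast (Nat.factorial_le hk3).trans (by decide)
  set g : (Fin n → ℝ) → ℝ := fun s => (-((1 + δ) / δ)) • logSumExp ((δ / (1 + δ)) • s) with hg
  set f : (Fin n → Fin m → ℝ) → Fin n → ℝ := fun x => (-(1 + δ)) • rowLogSumExp β x with hf
  have hS := contDiff_rowLogSumExp (n := n) (m := m) β (N := k)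
  have hl : ContDiff ℝ k fun s : Fin n → ℝ => logSumExp ((δ / (1 + δ)) • s) :=
    contDiff_logSumExp.comp (by fun_prop)
  have hl' : ∀ i ≤ k, ContDiff ℝ i fun s : Fin n → ℝ => logSumExp ((δ / (1 + δ)) • s) :=
    fun i _ => contDiff_logSumExp.comp (by fun_prop)
  have hgb : ∀ i, 1 ≤ i → i ≤ k → ‖iteratedFDeriv ℝ i g (f x)‖ ≤ 12 := by
    intro i hi hik
    rw [hg, iteratedFDeriv_const_smul_apply' (hl' i hik).contDiffAt, norm_smul,
      iteratedFDeriv_comp_const_smul _ contDiff_logSumExp, norm_smul, norm_neg, norm_pow,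
      Real.norm_of_nonneg (by positivity), Real.norm_of_nonneg (by positivity)]
    have h2 : (δ / (1 + δ)) ^ i ≤ δ / (1 + δ) := pow_le_of_le_one (by positivity) hr (by omega)
    calc _ ≤ (1 + δ) / δ * (δ / (1 + δ) * 12) := by
          gcongr
          exact norm_iteratedFDeriv_logSumExp_le _ hi (hik.trans hk3)
      _ = 12 := by field_simp
  have hfb : ∀ i, 1 ≤ i → i ≤ k → ‖iteratedFDeriv ℝ i f x‖ ≤ (12 * (β * (1 + δ))) ^ i := by
    intro i hi hik
    rw [hf, iteratedFDeriv_const_smul_apply' (contDiff_rowLogSumExp β).contDiffAt, norm_smul,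
      norm_neg, Real.norm_of_nonneg h1.le]
    have h3 : 1 + δ ≤ (1 + δ) ^ i := le_self_pow₀ (by linarith) (by omega)
    have h4 : (12 : ℝ) ≤ 12 ^ i := le_self_pow₀ (by norm_num) (by omega)
    calc _ ≤ (1 + δ) ^ i * (β ^ i * 12 ^ i) := by
          gcongr
          refine (norm_iteratedFDeriv_rowLogSumExp_le hβ.le x hi (hik.trans hk3)).trans ?_
          gcongr
      _ = _ := by rw [mul_pow, mul_pow]; ring
  have h := norm_iteratedFDeriv_comp_le_of_pos (g := g) (f := f) hk (hl.const_smul _)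
    (hS.const_smul _) x (by norm_num) hgb hfb
  have he : (fun x : Fin n → Fin m → ℝ => β * (1 + δ) * Fbd β δ x) = fun y => g (f y) := by
    ext y
    rw [Fbd_eq_logSumExp hβ hδ]
    simp only [hg, hf, smul_eq_mul]
  rw [he]
  refine h.trans ?_
  have h5 : (72 : ℝ) ≤ 72 ^ k := le_self_pow₀ (by norm_num) (by omega)
  calc _ ≤ 6 * 12 * (12 * (β * (1 + δ))) ^ k := by gcongr
    _ ≤ 72 ^ k * (12 * (β * (1 + δ))) ^ k := by gcongr; linarith
    _ = _ := by rw [← mul_pow]; ring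

lemma abs_iteratedDeriv_le_of_bounds {g : ℝ → ℝ} {a C τ : ℝ} (ha : 0 < a) (hτ : 0 < τ)
    (hC : 1 ≤ C) (h1 : ∀ t, |deriv g t| ≤ τ⁻¹) (h2 : ∀ t, |deriv (deriv g) t| ≤ C * a * τ⁻¹)
    (h3 : ∀ t, |deriv (deriv (deriv g)) t| ≤ C * a ^ 2 * τ⁻¹) {k : ℕ} (hk : 1 ≤ k) (hk3 : k ≤ 3)
    (t : ℝ) : (a⁻¹) ^ k * |iteratedDeriv k g t| ≤ C * (a * τ)⁻¹ := by
  rw [inv_pow, inv_mul_le_iff₀ (by positivity)]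
  interval_cases k
  · rw [iteratedDeriv_one]
    refine (h1 t).trans ?_
    rw [mul_inv]; field_simp; exact hC
  · rw [iteratedDeriv_succ', iteratedDeriv_one]
    refine (h2 t).trans (le_of_eq ?_)
    field_simp
  · rw [iteratedDeriv_succ', iteratedDeriv_succ', iteratedDeriv_one]
    refine (h3 t).trans (le_of_eq ?_)
    field_simp

lemma norm_iteratedFDeriv_comp_Fbd_le [NeZero n] [NeZero m] {β δ τ C : ℝ} (hβ : 0 < β)
    (hδ : 0 < δ) (hτ : 0 < τ) (hC : 1 ≤ C) {g : ℝ → ℝ} (hg : ContDiff ℝ 3 g)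
    (h1 : ∀ t, |deriv g t| ≤ τ⁻¹) (h2 : ∀ t, |deriv (deriv g) t| ≤ C * (β * (1 + δ)) * τ⁻¹)
    (h3 : ∀ t, |deriv (deriv (deriv g)) t| ≤ C * (β * (1 + δ)) ^ 2 * τ⁻¹)
    (x : Fin n → Fin m → ℝ) {k : ℕ} (hk : 1 ≤ k) (hk3 : k ≤ 3) :
    ‖iteratedFDeriv ℝ k (fun x : Fin n → Fin m → ℝ => g (Fbd β δ x)) x‖ ≤
      k.factorial * (C * (β * (1 + δ) * τ)⁻¹) * (864 * (β * (1 + δ))) ^ k := by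
  have ha : 0 < β * (1 + δ) := by positivity
  set a := β * (1 + δ) with hadef
  have he : (fun x : Fin n → Fin m → ℝ => g (Fbd β δ x)) =
      fun y => (fun s => g (a⁻¹ • s)) (a * Fbd β δ y) := by
    ext y; simp only [smul_eq_mul]; rw [inv_mul_cancel_left₀ ha.ne']
  rw [he]
  have hk' : (k : WithTop ℕ∞) ≤ 3 := by exact_mod_cast hk3
  refine norm_iteratedFDeriv_comp_le_of_pos (g := fun s => g (a⁻¹ • s)) hk
    ((hg.of_le hk').comp (by fun_prop)) (contDiff_mul_Fbd hβ hδ) x (by positivity) ?_ ?_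
  · intro i hi hik
    have hi' : (i : WithTop ℕ∞) ≤ 3 := by exact_mod_cast hik.trans hk3
    rw [iteratedFDeriv_comp_const_smul _ (hg.of_le hi'), norm_smul,
      norm_iteratedFDeriv_eq_norm_iteratedDeriv, norm_pow, Real.norm_of_nonneg (by positivity),
      Real.norm_eq_abs]
    exact abs_iteratedDeriv_le_of_bounds ha hτ hC h1 h2 h3 hi (hik.trans hk3) _
  · intro i hi hik
    exact norm_iteratedFDeriv_mul_Fbd_le hβ hδ x hi (hik.trans hk3)

lemma contDiff_comp_Fbd [NeZero n] [NeZero m] {β δ : ℝ} (hβ : 0 < β) (hδ : 0 < δ)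
    {N : WithTop ℕ∞} {g : ℝ → ℝ} (hg : ContDiff ℝ N g) :
    ContDiff ℝ N (fun x : Fin n → Fin m → ℝ => g (Fbd β δ x)) := by
  have ha : 0 < β * (1 + δ) := by positivity
  have he : (fun x : Fin n → Fin m → ℝ => g (Fbd β δ x)) =
      fun y => g ((β * (1 + δ))⁻¹ * (β * (1 + δ) * Fbd β δ y)) := by
    ext y; rw [inv_mul_cancel_left₀ ha.ne']
  rw [he]
  exact hg.comp (contDiff_const.mul (contDiff_mul_Fbd hβ hδ))

end MinMax

section Taylor

variable {E : Type*} [NormedAddCommGroup E] [NormedSpace ℝ E]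

lemma norm_fderiv_fderiv_sub_le {u : E → ℝ} (hu : ContDiff ℝ 3 u) {M : ℝ}
    (hM : ∀ x, ‖iteratedFDeriv ℝ 3 u x‖ ≤ M) (x y : E) :
    ‖fderiv ℝ (fderiv ℝ u) x - fderiv ℝ (fderiv ℝ u) y‖ ≤ M * ‖x - y‖ := by
  have h1 : ContDiff ℝ 1 (fderiv ℝ (fderiv ℝ u)) :=
    (hu.fderiv_right (m := 2) (by norm_num)).fderiv_right (by norm_num)
  refine Convex.norm_image_sub_le_of_norm_fderiv_le (𝕜 := ℝ) (s := Set.univ)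
    (fun z _ => (h1.differentiable (by norm_num)) z) (fun z _ => ?_) convex_univ trivial trivial
  rw [← norm_iteratedFDeriv_one, norm_iteratedFDeriv_fderiv, norm_iteratedFDeriv_fderiv]
  exact hM z

lemma abs_sub_taylor_le {u : E → ℝ} (hu : ContDiff ℝ 2 u) {M : ℝ} (hM0 : 0 ≤ M)
    (hM : ∀ x y, ‖fderiv ℝ (fderiv ℝ u) x - fderiv ℝ (fderiv ℝ u) y‖ ≤ M * ‖x - y‖)
    (p x : E) {a b : ℝ} (ha : 0 ≤ a) (hab : a ≤ b) :
    |u (p + b • x) - u (p + a • x) - (b - a) * fderiv ℝ u p x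
      - (b ^ 2 - a ^ 2) / 2 * fderiv ℝ (fderiv ℝ u) p x x| ≤ (b ^ 3 - a ^ 3) * (M * ‖x‖ ^ 3) := by
  have hd1 : Differentiable ℝ u := hu.differentiable (by norm_num)
  have hd2 : Differentiable ℝ (fderiv ℝ u) :=
    (hu.fderiv_right (m := 1) (by norm_num)).differentiable (by norm_num)
  have hline : ∀ s : ℝ, HasDerivAt (fun s : ℝ => p + s • x) x s := fun s => by
    simpa using ((hasDerivAt_id s).smul_const x).const_add p
  have hφ : ∀ s : ℝ, HasDerivAt (fun s : ℝ => u (p + s • x)) (fderiv ℝ u (p + s • x) x) s :=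
    fun s => (hd1 _).hasFDerivAt.comp_hasDerivAt s (hline s)
  have hφ' : ∀ s : ℝ, HasDerivAt (fun s : ℝ => fderiv ℝ u (p + s • x) x)
      (fderiv ℝ (fderiv ℝ u) (p + s • x) x x) s := fun s => by
    have := (hd2 (p + s • x)).hasFDerivAt.comp_hasDerivAt s (hline s)
    exact (ContinuousLinearMap.apply ℝ ℝ x).hasFDerivAt.comp_hasDerivAt s this
  set q1 := fderiv ℝ u p x with hq1
  set q2 := fderiv ℝ (fderiv ℝ u) p x x with hq2
  have hψ' : ∀ s : ℝ, HasDerivAt (fun s : ℝ => fderiv ℝ u (p + s • x) x - q1 - s * q2)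
      (fderiv ℝ (fderiv ℝ u) (p + s • x) x x - q2) s := fun s => by
    refine (((hφ' s).sub_const q1).sub ((hasDerivAt_id s).mul_const q2)).congr_deriv ?_
    simp
  have hψ : ∀ s : ℝ, HasDerivAt (fun s : ℝ => u (p + s • x) - s * q1 - s ^ 2 / 2 * q2)
      (fderiv ℝ u (p + s • x) x - q1 - s * q2) s := fun s => by
    have h1 := ((hφ s).sub ((hasDerivAt_id s).mul_const q1)).sub
      ((((hasDerivAt_id s).pow 2).div_const 2).mul_const q2)
    refine h1.congr_deriv ?_
    simp
  have hB : ∀ s ∈ Set.Icc 0 b, |fderiv ℝ u (p + s • x) x - q1 - s * q2| ≤ b * M * ‖x‖ ^ 3 * b := by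
    intro s hs
    have h2 := Convex.norm_image_sub_le_of_norm_hasDerivWithin_le (s := Set.Icc 0 b) (x := 0)
      (y := s) (C := b * M * ‖x‖ ^ 3) (fun r _ => (hψ' r).hasDerivWithinAt) (fun r hr => ?_)
      (convex_Icc 0 b) ⟨le_rfl, ha.trans hab⟩ hs
    · simp only [zero_smul, add_zero, zero_mul, sub_zero, Real.norm_eq_abs, ← hq1, sub_self] at h2
      refine h2.trans ?_
      rw [abs_of_nonneg hs.1]
      have : 0 ≤ b := ha.trans hab
      exact mul_le_mul_of_nonneg_left hs.2 (by positivity)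
    · rw [hq2, ← sub_apply, ← sub_apply]
      refine (ContinuousLinearMap.le_opNorm₂ _ x x).trans ?_
      have h3 := hM (p + r • x) p
      rw [add_sub_cancel_left, norm_smul, Real.norm_of_nonneg hr.1] at h3
      calc _ ≤ M * (r * ‖x‖) * ‖x‖ * ‖x‖ := by gcongr
        _ ≤ M * (b * ‖x‖) * ‖x‖ * ‖x‖ := by gcongr; exact hr.2
        _ = _ := by ring
  have h4 := Convex.norm_image_sub_le_of_norm_hasDerivWithin_le (s := Set.Icc 0 b) (x := a)
    (y := b) (fun r _ => (hψ r).hasDerivWithinAt) hB (convex_Icc 0 b) ⟨ha, hab⟩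
    ⟨ha.trans hab, le_rfl⟩
  rw [Real.norm_eq_abs, Real.norm_of_nonneg (sub_nonneg.2 hab)] at h4
  calc _ = |u (p + b • x) - b * q1 - b ^ 2 / 2 * q2 - (u (p + a • x) - a * q1 - a ^ 2 / 2 * q2)| := by
        congr 1; ring
    _ ≤ _ := h4
    _ = b ^ 2 * (b - a) * (M * ‖x‖ ^ 3) := by ring
    _ ≤ _ := by
      gcongr
      nlinarith [mul_nonneg (sub_nonneg.2 hab) (mul_nonneg ha (ha.trans hab)),
        mul_nonneg (sub_nonneg.2 hab) (sq_nonneg a)]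

end Taylor

lemma abs_integral_le_of_abs_le {α : Type*} [MeasurableSpace α] {ρ : Measure α} {F G : α → ℝ}
    (hG : Integrable G ρ) (h : ∀ x, |F x| ≤ G x) : |∫ x, F x ∂ρ| ≤ ∫ x, G x ∂ρ :=
  norm_integral_le_of_norm_le (f := F) hG (ae_of_all ρ h)

lemma LipschitzWith.integrable_comp_of_integrable {E α : Type*}
    [NormedAddCommGroup E] [MeasurableSpace α] {ρ : Measure α} [IsFiniteMeasure ρ] {K : NNReal}
    {u : E → ℝ} (hu : LipschitzWith K u) {h : α → E} (hh : Integrable h ρ) : Integrable (fun z => u (h z)) ρ := by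
  have hb : Integrable (fun z => |u 0| + K * ‖h z‖) ρ :=
    (integrable_const _).add (hh.norm.const_mul _)
  refine hb.mono' (hu.continuous.comp_aestronglyMeasurable hh.1) (ae_of_all _ fun z => ?_)
  have h1 := hu.dist_le_mul (h z) 0
  rw [Real.dist_eq, dist_zero_right] at h1
  calc _ = |u 0 + (u (h z) - u 0)| := by rw [Real.norm_eq_abs]; congr 1; ring
    _ ≤ _ := (abs_add_le _ _).trans (by gcongr)

lemma lipschitzWith_integral {E α : Type*} [NormedAddCommGroup E] [MeasurableSpace α]
    {ρ : Measure α} [IsProbabilityMeasure ρ] {K : NNReal} {u : E → ℝ} (hu : LipschitzWith K u)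
    {h : α → E} (hh : Integrable h ρ) : LipschitzWith K fun p => ∫ z, u (p + h z) ∂ρ := by
  have hi : ∀ p, Integrable (fun z => u (p + h z)) ρ := fun p =>
    hu.integrable_comp_of_integrable ((integrable_const p).add hh)
  refine LipschitzWith.of_dist_le_mul fun p p' => ?_
  rw [Real.dist_eq, ← integral_sub (hi p) (hi p')]
  refine (abs_integral_le_of_abs_le (integrable_const (K * dist p p')) fun z => ?_).trans ?_
  · simpa [Real.dist_eq] using hu.dist_le_mul (p + h z) (p' + h z)
  · simp

lemma norm_mul_integral_norm_sq_le {E : Type*} [NormedAddCommGroup E]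
    [MeasurableSpace E] {μ : Measure E} [IsProbabilityMeasure μ] (hμ : MemLp id 3 μ) {t : ℝ}
    (ht : 0 ≤ t) :
    t * ∫ x, ‖x‖ ^ 2 ∂μ ≤ (t ^ 3 + 2 * ∫ x, ‖x‖ ^ 3 ∂μ) / 3 := by
  have h3 : Integrable (fun x : E => ‖x‖ ^ 3) μ := hμ.integrable_norm_pow (by norm_num)
  have h2 : Integrable (fun x : E => ‖x‖ ^ 2) μ :=
    (hμ.mono_exponent (p := 2) (by norm_num)).integrable_norm_pow (by norm_num)
  calc t * ∫ x, ‖x‖ ^ 2 ∂μ = ∫ x, t * ‖x‖ ^ 2 ∂μ := (integral_const_mul _ _).symm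
    _ ≤ ∫ x, (t ^ 3 / 3 + 2 / 3 * ‖x‖ ^ 3) ∂μ := by
      refine integral_mono (h2.const_mul _) ((integrable_const _).add (h3.const_mul _)) fun x => ?_
      have hx := norm_nonneg x
      simp only
      nlinarith [mul_nonneg (add_nonneg ht (mul_nonneg zero_le_two hx)) (sq_nonneg (t - ‖x‖))]
    _ = _ := by
      rw [integral_add (integrable_const _) (h3.const_mul _), integral_const_mul]
      simp; ring

section Interpolation

variable {E : Type*} [NormedAddCommGroup E] [NormedSpace ℝ E] [MeasurableSpace E] [BorelSpace E]
  [SecondCountableTopology E]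

lemma integrable_bilin {μ : Measure E} (hμ : MemLp id 2 μ) (B : E →L[ℝ] E →L[ℝ] ℝ) :
    Integrable (fun x => B x x) μ := by
  have h2 : Integrable (fun x : E => ‖B‖ * ‖x‖ ^ 2) μ :=
    (hμ.integrable_norm_pow (by norm_num)).const_mul _
  refine h2.mono' (by fun_prop) (ae_of_all _ fun x => ?_)
  refine (B.le_opNorm₂ x x).trans (le_of_eq ?_)
  ring

variable {μ ν : Measure E} [IsProbabilityMeasure μ] [IsProbabilityMeasure ν]

lemma abs_integral_sub_taylor_le (hμ : MemLp id 3 μ) (hμ0 : ∀ L : E →L[ℝ] ℝ, ∫ x, L x ∂μ = 0)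
    {u : E → ℝ} (hu : ContDiff ℝ 2 u) {K : NNReal} (huK : LipschitzWith K u) {M : ℝ} (hM0 : 0 ≤ M)
    (hM : ∀ x y, ‖fderiv ℝ (fderiv ℝ u) x - fderiv ℝ (fderiv ℝ u) y‖ ≤ M * ‖x - y‖)
    (p : E) {a b : ℝ} (ha : 0 ≤ a) (hab : a ≤ b) :
    |∫ x, u (p + b • x) ∂μ - ∫ x, u (p + a • x) ∂μ
      - (b ^ 2 - a ^ 2) / 2 * ∫ x, fderiv ℝ (fderiv ℝ u) p x x ∂μ| ≤
      (b ^ 3 - a ^ 3) * (M * ∫ x, ‖x‖ ^ 3 ∂μ) := by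
  have hid : Integrable (fun x : E => x) μ := hμ.integrable (by norm_num)
  have h3 : Integrable (fun x : E => ‖x‖ ^ 3) μ := hμ.integrable_norm_pow (by norm_num)
  have hi : ∀ c : ℝ, Integrable (fun x => u (p + c • x)) μ := fun c =>
    huK.integrable_comp_of_integrable ((integrable_const p).add (hid.smul c))
  have hL : Integrable (fun x => fderiv ℝ u p x) μ := (fderiv ℝ u p).integrable_comp hid
  have hB := integrable_bilin (hμ.mono_exponent (by norm_num)) (fderiv ℝ (fderiv ℝ u) p)
  have key := abs_integral_le_of_abs_le ((h3.const_mul M).const_mul (b ^ 3 - a ^ 3))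
    (fun x => abs_sub_taylor_le hu hM0 hM p x ha hab)
  have hi1 : Integrable (fun x => u (p + b • x) - u (p + a • x)) μ := (hi b).sub (hi a)
  have hi2 : Integrable (fun x => u (p + b • x) - u (p + a • x) - (b - a) * fderiv ℝ u p x) μ :=
    hi1.sub (hL.const_mul _)
  rw [integral_sub hi2 (hB.const_mul _), integral_sub hi1 (hL.const_mul _), integral_sub (hi b) (hi a),
    integral_const_mul, integral_const_mul, integral_const_mul, integral_const_mul, hμ0] at key
  simpa using key

lemma abs_integral_sub_integral_integral_le (hμ : MemLp id 3 μ) (hν : MemLp id 3 ν)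
    (hμ0 : ∀ L : E →L[ℝ] ℝ, ∫ x, L x ∂μ = 0) (hν0 : ∀ L : E →L[ℝ] ℝ, ∫ x, L x ∂ν = 0)
    (hcov : ∀ B : E →L[ℝ] E →L[ℝ] ℝ, ∫ x, B x x ∂μ = ∫ x, B x x ∂ν)
    {u : E → ℝ} (hu : ContDiff ℝ 2 u) {K : NNReal} (huK : LipschitzWith K u) {M : ℝ} (hM0 : 0 ≤ M)
    (hM : ∀ x y, ‖fderiv ℝ (fderiv ℝ u) x - fderiv ℝ (fderiv ℝ u) y‖ ≤ M * ‖x - y‖)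
    (p : E) {a b s : ℝ} (ha : 0 ≤ a) (hab : a ≤ b) (hs : 0 ≤ s) (hs2 : s ^ 2 = b ^ 2 - a ^ 2) :
    |∫ x, u (p + b • x) ∂μ - ∫ x, ∫ y, u (p + a • x + s • y) ∂ν ∂μ| ≤
      (b ^ 3 - a ^ 3) * (M * ∫ x, ‖x‖ ^ 3 ∂μ) + s ^ 3 * (M * ∫ y, ‖y‖ ^ 3 ∂ν)
        + s ^ 2 / 2 * (a * (M * ∫ x, ‖x‖ ^ 3 ∂μ)) := by
  have hid : Integrable (fun x : E => x) μ := hμ.integrable (by norm_num)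
  have hidν : Integrable (fun x : E => x) ν := hν.integrable (by norm_num)
  have h3 : Integrable (fun x : E => ‖x‖ ^ 3) μ := hμ.integrable_norm_pow (by norm_num)
  have h2 : Integrable (fun x : E => ‖x‖ ^ 2) μ :=
    (hμ.mono_exponent (p := 2) (by norm_num)).integrable_norm_pow (by norm_num)
  set S := ∫ x, ‖x‖ ^ 3 ∂μ
  set T := ∫ y, ‖y‖ ^ 3 ∂ν
  set D := fderiv ℝ (fderiv ℝ u) with hD
  set q := ∫ x, D p x x ∂μ
  have e1 := abs_integral_sub_taylor_le hμ hμ0 hu huK hM0 hM p ha hab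
  have hq : ∀ z, |∫ y, D z y y ∂ν - q| ≤ M * ‖z - p‖ * ∫ x, ‖x‖ ^ 2 ∂μ := by
    intro z
    rw [← hcov, ← integral_sub (integrable_bilin (hμ.mono_exponent (by norm_num)) _)
      (integrable_bilin (hμ.mono_exponent (by norm_num)) _), ← integral_const_mul]
    refine abs_integral_le_of_abs_le (h2.const_mul _) fun x => ?_
    refine ((D z - D p).le_opNorm₂ x x).trans ?_
    rw [mul_assoc, ← sq]
    gcongr
    exact hM z p
  have e2 : ∀ x, |∫ y, u (p + a • x + s • y) ∂ν - u (p + a • x) - s ^ 2 / 2 * q| ≤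
      s ^ 3 * (M * T) + s ^ 2 / 2 * (M * a * ((‖x‖ ^ 3 + 2 * S) / 3)) := by
    intro x
    have h5 := abs_integral_sub_taylor_le hν hν0 hu huK hM0 hM (p + a • x) le_rfl hs
    simp only [zero_smul, add_zero, integral_const, probReal_univ, one_smul, ne_eq,
      OfNat.ofNat_ne_zero, not_false_eq_true, zero_pow, sub_zero] at h5
    have h6 := hq (p + a • x)
    rw [add_sub_cancel_left, norm_smul, Real.norm_of_nonneg ha] at h6
    have h7 : M * (a * ‖x‖) * ∫ x, ‖x‖ ^ 2 ∂μ ≤ M * a * ((‖x‖ ^ 3 + 2 * S) / 3) := by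
      rw [← mul_assoc, mul_assoc (M * a)]
      gcongr
      exact norm_mul_integral_norm_sq_le hμ (norm_nonneg x)
    have h8 : |s ^ 2 / 2 * (∫ y, D (p + a • x) y y ∂ν - q)| ≤
        s ^ 2 / 2 * (M * a * ((‖x‖ ^ 3 + 2 * S) / 3)) := by
      rw [abs_mul, abs_of_nonneg (by positivity : 0 ≤ s ^ 2 / 2)]
      gcongr
      exact h6.trans h7
    refine le_trans (le_of_eq ?_) ((abs_add_le _ _).trans (add_le_add h5 h8))
    congr 1
    ring
  have hprod : Integrable (fun z : E × E => u (p + a • z.1 + s • z.2)) (μ.prod ν) :=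
    huK.integrable_comp_of_integrable
      (((integrable_const p).add ((hid.comp_fst ν).smul a)).add ((hidν.comp_snd μ).smul s))
  have hI : Integrable (fun x => ∫ y, u (p + a • x + s • y) ∂ν) μ := hprod.integral_prod_left
  have hua : Integrable (fun x => u (p + a • x)) μ :=
    huK.integrable_comp_of_integrable ((integrable_const p).add (hid.smul a))
  have hR : Integrable (fun x => s ^ 2 / 2 * (M * a * ((‖x‖ ^ 3 + 2 * S) / 3))) μ :=
    (((h3.add (integrable_const (2 * S))).div_const 3).const_mul (M * a)).const_mul (s ^ 2 / 2)
  have hR' : Integrable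
      (fun x => s ^ 3 * (M * T) + s ^ 2 / 2 * (M * a * ((‖x‖ ^ 3 + 2 * S) / 3))) μ :=
    (integrable_const _).add hR
  have e3 := abs_integral_le_of_abs_le hR' e2
  have e4 : ∫ x, (s ^ 3 * (M * T) + s ^ 2 / 2 * (M * a * ((‖x‖ ^ 3 + 2 * S) / 3))) ∂μ =
      s ^ 3 * (M * T) + s ^ 2 / 2 * (a * (M * S)) := by
    rw [integral_add (integrable_const _) hR,
      integral_const_mul (s ^ 2 / 2), integral_const_mul (M * a), integral_div,
      integral_add h3 (integrable_const _)]
    simp only [integral_const, probReal_univ, one_smul]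
    ring
  have hI' : Integrable (fun x => ∫ y, u (p + a • x + s • y) ∂ν - u (p + a • x)) μ := hI.sub hua
  rw [e4, integral_sub hI' (integrable_const _), integral_sub hI hua] at e3
  simp only [integral_const, probReal_univ, one_smul] at e3
  rw [← hs2] at e1
  rw [abs_le] at e1 e3 ⊢
  constructor <;> linarith [e1.1, e1.2, e3.1, e3.2]

variable [CompleteSpace E]

lemma map_prod_gaussian_smul_add [IsGaussian ν] (hν0 : ∀ L : E →L[ℝ] ℝ, ∫ x, L x ∂ν = 0)
    {r c s : ℝ} (h : r ^ 2 = c ^ 2 + s ^ 2) :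
    (ν.prod ν).map (fun z : E × E => c • z.1 + s • z.2) = ν.map (fun y => r • y) := by
  let A : E × E →L[ℝ] E :=
    c • ContinuousLinearMap.fst ℝ E E + s • ContinuousLinearMap.snd ℝ E E
  let B : E →L[ℝ] E := r • ContinuousLinearMap.id ℝ E
  have hA : IsProbabilityMeasure ((ν.prod ν).map A) :=
    Measure.isProbabilityMeasure_map A.continuous.measurable.aemeasurable
  have hB : IsProbabilityMeasure (ν.map B) :=
    Measure.isProbabilityMeasure_map B.continuous.measurable.aemeasurable
  change (ν.prod ν).map A = ν.map B
  refine Measure.ext_of_charFunDual ?_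
  ext L
  have h1 : (L.comp A).comp (.inl ℝ E E) = c • L := by ext x; simp [A]
  have h2 : (L.comp A).comp (.inr ℝ E E) = s • L := by ext x; simp [A]
  have h3 : L.comp B = r • L := by ext x; simp [B]
  simp_rw [charFunDual_map, charFunDual_prod, h1, h2, h3,
    IsGaussian.charFunDual_eq_of_forall_strongDual_eq_zero hν0, ← Complex.exp_add]
  simp only [FunLike.coe_smul, variance_smul, h]
  congr 1
  push_cast
  ring

lemma integral_smul_gaussian [IsGaussian ν] (hν0 : ∀ L : E →L[ℝ] ℝ, ∫ x, L x ∂ν = 0)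
    {r c s : ℝ} (h : r ^ 2 = c ^ 2 + s ^ 2) {H : E → ℝ} {K : NNReal} (hH : LipschitzWith K H) :
    ∫ y, H (r • y) ∂ν = ∫ y, ∫ y', H (c • y + s • y') ∂ν ∂ν := by
  have hid : Integrable (fun x : E => x) ν := IsGaussian.integrable_id
  have e1 := integral_map (μ := ν) (φ := fun y : E => r • y) (f := H) (by fun_prop)
    hH.continuous.aestronglyMeasurable
  rw [← e1, ← map_prod_gaussian_smul_add hν0 h,
    integral_map (by fun_prop) hH.continuous.aestronglyMeasurable]
  exact integral_prod _ (hH.integrable_comp_of_integrable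
    (((hid.comp_fst ν).smul c).add ((hid.comp_snd ν).smul s)))

lemma abs_integral_interpolation_sub_le [IsGaussian ν] (hμ : MemLp id 3 μ)
    (hμ0 : ∀ L : E →L[ℝ] ℝ, ∫ x, L x ∂μ = 0) (hν0 : ∀ L : E →L[ℝ] ℝ, ∫ x, L x ∂ν = 0)
    (hcov : ∀ B : E →L[ℝ] E →L[ℝ] ℝ, ∫ x, B x x ∂μ = ∫ x, B x x ∂ν)
    {u : E → ℝ} (hu : ContDiff ℝ 2 u) {K : NNReal} (huK : LipschitzWith K u) {M : ℝ} (hM0 : 0 ≤ M)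
    (hM : ∀ x y, ‖fderiv ℝ (fderiv ℝ u) x - fderiv ℝ (fderiv ℝ u) y‖ ≤ M * ‖x - y‖)
    {a b c r s : ℝ} (ha : 0 ≤ a) (hab : a ≤ b) (hs : 0 ≤ s) (hs2 : s ^ 2 = b ^ 2 - a ^ 2)
    (hr : r ^ 2 = c ^ 2 + s ^ 2) :
    |∫ y, ∫ x, u (c • y + b • x) ∂μ ∂ν - ∫ y, ∫ x, u (r • y + a • x) ∂μ ∂ν| ≤
      (b ^ 3 - a ^ 3) * (M * ∫ x, ‖x‖ ^ 3 ∂μ) + s ^ 3 * (M * ∫ y, ‖y‖ ^ 3 ∂ν)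
        + s ^ 2 / 2 * (a * (M * ∫ x, ‖x‖ ^ 3 ∂μ)) := by
  have hν : MemLp id 3 ν := IsGaussian.memLp_id ν 3 (by norm_num)
  have hid : Integrable (fun x : E => x) μ := hμ.integrable (by norm_num)
  have hidν : Integrable (fun x : E => x) ν := hν.integrable (by norm_num)
  have hHa : LipschitzWith K fun p => ∫ x, u (p + a • x) ∂μ :=
    lipschitzWith_integral huK (hid.smul a)
  have hHb : LipschitzWith K fun p => ∫ x, u (p + b • x) ∂μ :=
    lipschitzWith_integral huK (hid.smul b)
  have hprod : Integrable (fun z : E × E => ∫ x, u (c • z.1 + s • z.2 + a • x) ∂μ) (ν.prod ν) :=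
    hHa.integrable_comp_of_integrable (((hidν.comp_fst ν).smul c).add ((hidν.comp_snd ν).smul s))
  have hswap : ∀ y, ∫ y', ∫ x, u (c • y + s • y' + a • x) ∂μ ∂ν =
      ∫ x, ∫ y', u (c • y + a • x + s • y') ∂ν ∂μ := fun y => by
    rw [integral_integral_swap (f := fun y' x => u (c • y + s • y' + a • x))
      (huK.integrable_comp_of_integrable (((integrable_const _).add
        ((hidν.comp_fst μ).smul s)).add ((hid.comp_snd ν).smul a)))]
    simp only [add_right_comm]
  have hI : Integrable (fun y => ∫ x, u (c • y + b • x) ∂μ) ν :=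
    hHb.integrable_comp_of_integrable (hidν.smul c)
  rw [integral_smul_gaussian hν0 hr hHa, ← integral_sub hI hprod.integral_prod_left]
  refine (abs_integral_le_of_abs_le (integrable_const _) fun y => ?_).trans
    (le_of_eq (by rw [integral_const, probReal_univ, one_smul]))
  rw [hswap]
  exact abs_integral_sub_integral_integral_le hμ hν hμ0 hν0 hcov hu huK hM0 hM (c • y) ha hab hs hs2

/-- Comparison of a centered measure with the Gaussian measure of the same covariance, for test
functions with Lipschitz second derivative. -/
lemma abs_integral_sub_integral_gaussian_le [IsGaussian ν] (hμ : MemLp id 3 μ)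
    (hμ0 : ∀ L : E →L[ℝ] ℝ, ∫ x, L x ∂μ = 0) (hν0 : ∀ L : E →L[ℝ] ℝ, ∫ x, L x ∂ν = 0)
    (hcov : ∀ B : E →L[ℝ] E →L[ℝ] ℝ, ∫ x, B x x ∂μ = ∫ x, B x x ∂ν)
    {u : E → ℝ} (hu : ContDiff ℝ 2 u) {K : NNReal} (huK : LipschitzWith K u) {M : ℝ} (hM0 : 0 ≤ M)
    (hM : ∀ x y, ‖fderiv ℝ (fderiv ℝ u) x - fderiv ℝ (fderiv ℝ u) y‖ ≤ M * ‖x - y‖) :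
    |∫ x, u x ∂μ - ∫ y, u y ∂ν| ≤ 3 / 2 * (M * ∫ x, ‖x‖ ^ 3 ∂μ) := by
  set S := ∫ x, ‖x‖ ^ 3 ∂μ
  set T := ∫ y, ‖y‖ ^ 3 ∂ν
  have hS : 0 ≤ M * S := mul_nonneg hM0 (integral_nonneg fun x => by positivity)
  have key : ∀ k : ℕ, |∫ x, u x ∂μ - ∫ y, u y ∂ν| ≤
      3 / 2 * (M * S) + √(1 / ((k : ℝ) + 1)) * (M * T) := by
    intro k
    have hN : (0 : ℝ) < k + 1 := by positivity
    set N : ℝ := k + 1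
    set s := √(1 / N)
    have hs2 : s ^ 2 = 1 / N := Real.sq_sqrt (by positivity)
    set Φ : ℕ → ℝ := fun j => ∫ y, ∫ x, u (√(1 - j / N) • y + √(j / N) • x) ∂μ ∂ν with hΦ
    have hstep : ∀ j : ℕ, j ≤ k + 1 → |Φ j - Φ 0| ≤
        √(j / N) ^ 3 * (M * S) + j * (s ^ 3 * (M * T) + s ^ 2 / 2 * (M * S)) := by
      intro j
      induction j with
      | zero => simp
      | succ j ih =>
        intro hj
        have hj1 : ((j + 1 : ℕ) : ℝ) / N ≤ 1 := by
          rw [div_le_one hN]; simp only [N]; exact_mod_cast hj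
        have hj2 : (j : ℝ) / N ≤ ((j + 1 : ℕ) : ℝ) / N := by gcongr; simp
        have h1 := abs_integral_interpolation_sub_le (c := √(1 - ((j + 1 : ℕ) : ℝ) / N))
          (r := √(1 - j / N)) hμ hμ0 hν0 hcov hu huK hM0 hM
          (Real.sqrt_nonneg (j / N)) (Real.sqrt_le_sqrt hj2) (Real.sqrt_nonneg (1 / N))
          (by
            rw [Real.sq_sqrt (by positivity), Real.sq_sqrt (by positivity),
              Real.sq_sqrt (by positivity)]
            push_cast; ring)
          (by
            rw [Real.sq_sqrt (by linarith), Real.sq_sqrt (by linarith),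
              Real.sq_sqrt (by positivity)]
            push_cast; ring)
        have h2 : √(j / N) * (M * S) ≤ 1 * (M * S) := by
          gcongr
          exact Real.sqrt_le_one.2 (hj2.trans hj1)
        have h3 : s ^ 2 / 2 * (√(j / N) * (M * S)) ≤ s ^ 2 / 2 * (1 * (M * S)) := by gcongr
        have h4 := abs_add_le (Φ (j + 1) - Φ j) (Φ j - Φ 0)
        rw [sub_add_sub_cancel] at h4
        have h5 := ih (by omega)
        change |Φ (j + 1) - Φ j| ≤ _ at h1
        refine h4.trans ((add_le_add (h1.trans (add_le_add le_rfl h3)) h5).trans (le_of_eq ?_))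
        push_cast
        ring
    have hlast := hstep (k + 1) le_rfl
    have hNN : ((k + 1 : ℕ) : ℝ) = N := by simp [N]
    have hΦ1 : Φ (k + 1) = ∫ x, u x ∂μ := by
      simp only [hΦ, hNN]
      simp [div_self hN.ne']
    have hΦ0 : Φ 0 = ∫ y, u y ∂ν := by simp [hΦ]
    rw [hΦ1, hΦ0, hNN, div_self hN.ne'] at hlast
    refine hlast.trans (le_of_eq ?_)
    have hs3 : s ^ 3 = s * (1 / N) := by rw [← hs2]; ring
    rw [hs3, hs2, Real.sqrt_one]
    field_simp
    ring
  have hlim : Filter.Tendsto (fun k : ℕ => 3 / 2 * (M * S) + √(1 / ((k : ℝ) + 1)) * (M * T))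
      Filter.atTop (nhds (3 / 2 * (M * S) + √0 * (M * T))) :=
    ((tendsto_one_div_add_atTop_nhds_zero_nat.sqrt).mul_const _).const_add _
  simpa using ge_of_tendsto' hlim key

end Interpolation

section RandomMatrix

variable {n m : ℕ}

lemma map_matrix_eq_sum {F : Type*} [NormedAddCommGroup F] [NormedSpace ℝ F]
    (L : (Fin n → Fin m → ℝ) →L[ℝ] F) (x : Fin n → Fin m → ℝ) :
    L x = ∑ i, ∑ j, x i j • L (Pi.single i (Pi.single j 1)) := by
  have h : x = ∑ i, ∑ j, x i j • Pi.single i (Pi.single j (1 : ℝ)) := by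
    ext i j
    simp [Finset.sum_apply, Pi.single_apply, ite_apply]
  conv_lhs => rw [h]
  simp only [map_sum, map_smul]

lemma norm_pow_three_eq_iSup [NeZero n] [NeZero m] (x : Fin n → Fin m → ℝ) :
    ‖x‖ ^ 3 = ⨆ i, ⨆ j, |x i j| ^ 3 := by
  apply le_antisymm
  · obtain ⟨i, hi⟩ := exists_eq_ciSup_of_finite (f := fun i => ‖x i‖)
    obtain ⟨j, hj⟩ := exists_eq_ciSup_of_finite (f := fun j => ‖x i j‖)
    have h : ‖x‖ ≤ |x i j| := by
      refine (pi_norm_le_iff_of_nonneg (abs_nonneg _)).2 fun i' => ?_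
      refine (le_ciSup (Set.finite_range fun i => ‖x i‖).bddAbove i').trans (hi.symm.le.trans ?_)
      refine (pi_norm_le_iff_of_nonneg (abs_nonneg _)).2 fun j' => ?_
      exact (le_ciSup (Set.finite_range fun j => ‖x i j‖).bddAbove j').trans hj.symm.le
    calc ‖x‖ ^ 3 ≤ |x i j| ^ 3 := by gcongr
      _ ≤ ⨆ j, |x i j| ^ 3 := le_ciSup (Set.finite_range fun j => |x i j| ^ 3).bddAbove j
      _ ≤ _ := le_ciSup (Set.finite_range fun i => ⨆ j, |x i j| ^ 3).bddAbove i
  · refine ciSup_le fun i => ciSup_le fun j => ?_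
    gcongr
    exact (norm_le_pi_norm (x i) j).trans (norm_le_pi_norm x i)

variable {Ω : Type*} [MeasurableSpace Ω] {P : Measure Ω} {X Y : Ω → Fin n → Fin m → ℝ}

lemma memLp_three_of_integrable_entries (hX : Measurable X)
    (hX3 : ∀ i j, Integrable (fun ω => |X ω i j| ^ 3) P) : MemLp X 3 P := by
  refine MemLp.of_eval fun i => MemLp.of_eval fun j => ?_
  have hm : Measurable fun ω => X ω i j := by fun_prop
  rw [← integrable_norm_rpow_iff hm.aestronglyMeasurable (by norm_num) (by norm_num)]
  simpa using hX3 i j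

lemma integral_map_dual_eq_zero [IsProbabilityMeasure P] (hX : Measurable X) (hX3 : MemLp X 3 P)
    (hX0 : ∀ i j, ∫ ω, X ω i j ∂P = 0) (L : (Fin n → Fin m → ℝ) →L[ℝ] ℝ) :
    ∫ x, L x ∂P.map X = 0 := by
  have hi : ∀ i j, Integrable (fun ω => X ω i j) P := fun i j =>
    ((hX3.eval i).eval j).integrable (by norm_num)
  rw [integral_map hX.aemeasurable (by fun_prop)]
  rw [integral_congr_ae (ae_of_all _ fun ω => map_matrix_eq_sum L (X ω))]
  rw [integral_finsetSum _ fun i _ => integrable_finsetSum _ fun j _ => (hi i j).smul_const _]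
  refine Finset.sum_eq_zero fun i _ => ?_
  rw [integral_finsetSum _ fun j _ => (hi i j).smul_const _]
  refine Finset.sum_eq_zero fun j _ => ?_
  rw [integral_smul_const, hX0, zero_smul]

lemma integral_map_bilin_eq_sum (hX : Measurable X) (hX2 : MemLp X 2 P)
    (B : (Fin n → Fin m → ℝ) →L[ℝ] (Fin n → Fin m → ℝ) →L[ℝ] ℝ) :
    ∫ x, B x x ∂P.map X = ∑ i₁, ∑ j₁, ∑ i₂, ∑ j₂, (∫ ω, X ω i₁ j₁ * X ω i₂ j₂ ∂P) *
      B (Pi.single i₁ (Pi.single j₁ 1)) (Pi.single i₂ (Pi.single j₂ 1)) := by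
  have hi : ∀ i₁ j₁ i₂ j₂, Integrable (fun ω => X ω i₁ j₁ * X ω i₂ j₂ *
      B (Pi.single i₁ (Pi.single j₁ 1)) (Pi.single i₂ (Pi.single j₂ 1))) P := fun i₁ j₁ i₂ j₂ =>
    (((hX2.eval i₁).eval j₁).integrable_mul ((hX2.eval i₂).eval j₂)).mul_const _
  have hB : ∀ x, B x x = ∑ i₁, ∑ j₁, ∑ i₂, ∑ j₂, x i₁ j₁ * x i₂ j₂ *
      B (Pi.single i₁ (Pi.single j₁ 1)) (Pi.single i₂ (Pi.single j₂ 1)) := fun x => by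
    rw [map_matrix_eq_sum B x]
    simp_rw [_root_.sum_apply, FunLike.coe_smul, Pi.smul_apply, map_matrix_eq_sum (B _) x,
      Finset.smul_sum, smul_eq_mul, mul_assoc]
  rw [integral_map hX.aemeasurable (by fun_prop)]
  rw [integral_congr_ae (ae_of_all _ fun ω => hB (X ω))]
  rw [integral_finsetSum _ fun i₁ _ => integrable_finsetSum _ fun j₁ _ =>
    integrable_finsetSum _ fun i₂ _ => integrable_finsetSum _ fun j₂ _ => hi i₁ j₁ i₂ j₂]
  refine Finset.sum_congr rfl fun i₁ _ => ?_
  rw [integral_finsetSum _ fun j₁ _ => integrable_finsetSum _ fun i₂ _ =>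
    integrable_finsetSum _ fun j₂ _ => hi i₁ j₁ i₂ j₂]
  refine Finset.sum_congr rfl fun j₁ _ => ?_
  rw [integral_finsetSum _ fun i₂ _ => integrable_finsetSum _ fun j₂ _ => hi i₁ j₁ i₂ j₂]
  refine Finset.sum_congr rfl fun i₂ _ => ?_
  rw [integral_finsetSum _ fun j₂ _ => hi i₁ j₁ i₂ j₂]
  exact Finset.sum_congr rfl fun j₂ _ => integral_mul_const _ _

lemma IsCenteredGaussianMatrix.exists_map_map_eq (hY : Measurable Y)
    (hYG : IsCenteredGaussianMatrix P Y) (L : (Fin n → Fin m → ℝ) →L[ℝ] ℝ) :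
    ∃ v : NNReal, (P.map Y).map L = gaussianReal 0 v := by
  obtain ⟨v, hv⟩ := hYG fun i j => L (Pi.single i (Pi.single j 1))
  refine ⟨v, ?_⟩
  rw [Measure.map_map (by fun_prop) hY, ← hv]
  congr 1
  ext ω
  simp [map_matrix_eq_sum L (Y ω), mul_comm]

lemma IsCenteredGaussianMatrix.isGaussian_map (hY : Measurable Y)
    (hYG : IsCenteredGaussianMatrix P Y) : IsGaussian (P.map Y) :=
  isGaussian_of_map_eq_gaussianReal fun L => ⟨0, hYG.exists_map_map_eq hY L⟩

lemma IsCenteredGaussianMatrix.integral_map_dual_eq_zero (hY : Measurable Y)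
    (hYG : IsCenteredGaussianMatrix P Y) (L : (Fin n → Fin m → ℝ) →L[ℝ] ℝ) :
    ∫ x, L x ∂P.map Y = 0 := by
  obtain ⟨v, hv⟩ := hYG.exists_map_map_eq hY L
  have h := integral_map (μ := P.map Y) (φ := L) (f := fun t : ℝ => t) (by fun_prop) (by fun_prop)
  rw [← h, hv, integral_id_gaussianReal]

end RandomMatrix

theorem stmt_15 (C₀ : ℝ) (hC₀ : 0 < C₀) :
    ∃ C : ℝ, 0 < C ∧
      ∀ (n m : ℕ), 1 ≤ n → 1 ≤ m →
      ∀ (Ω : Type) [MeasurableSpace Ω] (P : Measure Ω), IsProbabilityMeasure P →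
      ∀ (X Y : Ω → Fin n → Fin m → ℝ), Measurable X → Measurable Y →
      (∀ i j, ∫ ω, X ω i j ∂P = 0) →
      (∀ i j, Integrable (fun ω => |X ω i j| ^ 3) P) →
      IsCenteredGaussianMatrix P Y →
      (∀ i₁ j₁ i₂ j₂, ∫ ω, X ω i₁ j₁ * X ω i₂ j₂ ∂P = ∫ ω, Y ω i₁ j₁ * Y ω i₂ j₂ ∂P) →
      ∀ (β δ τ : ℝ), 0 < β → 0 < δ → 1 / (β * (1 + δ)) < τ →
      ∀ g : ℝ → ℝ, ContDiff ℝ (⊤ : ℕ∞) g →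
      (∀ t, |deriv g t| ≤ τ⁻¹) →
      (∀ t, |deriv (deriv g) t| ≤ C₀ * β * (1 + δ) * τ⁻¹) →
      (∀ t, |deriv (deriv (deriv g)) t| ≤ C₀ * β ^ 2 * (1 + δ) ^ 2 * τ⁻¹) →
      |(∫ ω, g (Fbd β δ (X ω)) ∂P) - ∫ ω, g (Fbd β δ (Y ω)) ∂P| ≤
        C * β * (1 + δ) / τ *
          ((∫ ω, ⨆ i₁, ⨆ j₁, ⨆ i₂, ⨆ j₂,
              |X ω i₁ j₁ * X ω i₂ j₂ - ∫ ω', X ω' i₁ j₁ * X ω' i₂ j₂ ∂P| ∂P)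
            + β * (1 + δ) * ∫ ω, ⨆ i, ⨆ j, |X ω i j| ^ 3 ∂P) := by
  set C₁ := max 1 C₀
  have hC₁ : 1 ≤ C₁ := le_max_left _ _
  have hC₀₁ : C₀ ≤ C₁ := le_max_right _ _
  refine ⟨9 * 864 ^ 3 * C₁, by positivity, ?_⟩
  intro n m hn hm Ω _ P _ X Y hX hY hX0 hX3 hYG hcov β δ τ hβ hδ hτ g hg h1 h2 h3
  have : NeZero n := ⟨by omega⟩
  have : NeZero m := ⟨by omega⟩
  have hlam : 0 < β * (1 + δ) := by positivity
  have hτ0 : 0 < τ := (one_div_pos.2 hlam).trans hτ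
  have hg3 : ContDiff ℝ 3 g := mod_cast contDiff_infty.1 hg 3
  have h2' : ∀ t, |deriv (deriv g) t| ≤ C₁ * (β * (1 + δ)) * τ⁻¹ := fun t =>
    (h2 t).trans (by rw [mul_assoc C₀]; gcongr)
  have h3' : ∀ t, |deriv (deriv (deriv g)) t| ≤ C₁ * (β * (1 + δ)) ^ 2 * τ⁻¹ := fun t =>
    (h3 t).trans (by rw [mul_assoc C₀, ← mul_pow]; gcongr)
  set u : (Fin n → Fin m → ℝ) → ℝ := fun x => g (Fbd β δ x)
  have hu : ContDiff ℝ 3 u := contDiff_comp_Fbd hβ hδ hg3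
  have hbound : ∀ x, ∀ k, 1 ≤ k → k ≤ 3 → ‖iteratedFDeriv ℝ k u x‖ ≤ _ := fun x k hk hk3 =>
    norm_iteratedFDeriv_comp_Fbd_le hβ hδ hτ0 hC₁ hg3 h1 h2' h3' x hk hk3
  set M := 6 * (C₁ * (β * (1 + δ) * τ)⁻¹) * (864 * (β * (1 + δ))) ^ 3 with hM_def
  have hM0 : 0 ≤ M := by positivity
  obtain ⟨K, huK⟩ : ∃ K : NNReal, LipschitzWith K u := by
    refine ⟨Real.toNNReal (Nat.factorial 1 * (C₁ * (β * (1 + δ) * τ)⁻¹) * (864 * (β * (1 + δ))) ^ 1),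
      lipschitzWith_of_nnnorm_fderiv_le (hu.differentiable (by norm_num)) fun x => ?_⟩
    rw [← norm_toNNReal, ← norm_iteratedFDeriv_one]
    exact Real.toNNReal_le_toNNReal (hbound x 1 le_rfl (by norm_num))
  have hXm : MemLp X 3 P := memLp_three_of_integrable_entries hX hX3
  have hνG : IsGaussian (P.map Y) := hYG.isGaussian_map hY
  have hYm : MemLp Y 2 P :=
    (memLp_map_measure_iff aestronglyMeasurable_id hY.aemeasurable).1
      (IsGaussian.memLp_id (P.map Y) 2 (by norm_num))
  have : IsProbabilityMeasure (P.map X) := Measure.isProbabilityMeasure_map hX.aemeasurable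
  have main := abs_integral_sub_integral_gaussian_le
    ((memLp_map_measure_iff aestronglyMeasurable_id hX.aemeasurable).2 hXm)
    (integral_map_dual_eq_zero hX hXm hX0) (hYG.integral_map_dual_eq_zero hY)
    (fun B => by
      rw [integral_map_bilin_eq_sum hX (hXm.mono_exponent (by norm_num)),
        integral_map_bilin_eq_sum hY hYm]
      simp_rw [hcov])
    (hu.of_le (by norm_num)) huK hM0
    (norm_fderiv_fderiv_sub_le hu fun x => (hbound x 3 (by norm_num) le_rfl).trans_eq
      (by simp [hM_def, Nat.factorial]))
  rw [integral_map hX.aemeasurable huK.continuous.aestronglyMeasurable,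
    integral_map hY.aemeasurable huK.continuous.aestronglyMeasurable,
    integral_map hX.aemeasurable (by fun_prop)] at main
  simp_rw [norm_pow_three_eq_iSup] at main
  refine main.trans ?_
  set B₂ := ∫ ω, ⨆ i, ⨆ j, |X ω i j| ^ 3 ∂P
  have hB₁ : 0 ≤ ∫ ω, ⨆ i₁, ⨆ j₁, ⨆ i₂, ⨆ j₂,
      |X ω i₁ j₁ * X ω i₂ j₂ - ∫ ω', X ω' i₁ j₁ * X ω' i₂ j₂ ∂P| ∂P :=
    integral_nonneg fun ω => Real.iSup_nonneg fun _ => Real.iSup_nonneg fun _ =>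
      Real.iSup_nonneg fun _ => Real.iSup_nonneg fun _ => abs_nonneg _
  calc 3 / 2 * (M * B₂)
      = 9 * 864 ^ 3 * C₁ * β * (1 + δ) / τ * (β * (1 + δ) * B₂) := by
        rw [hM_def]; field_simp; ring
    _ ≤ _ := by gcongr; exact le_add_of_nonneg_left hB₁
end
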